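/- Determinant formula: for every integer l ≥ 1, every function F : ℂ^m × ℂ^r → ℂ, and every point (x, y) ∈ ℂ^m × ℂ^r that is admissible for the identity (every bracket value occurring in a denominator of any coefficient of the iterated sums is nonzero), one has (H_{m,r}^{(l)} F)(x; y) = (−1)^l Σ_{σ ∈ S_l} sgn(σ) ( A_{1,σ(1)} ∘ A_{2,σ(2)} ∘ ⋯ ∘ A_{l,σ(l)} F )(x; y), where for 1 ≤ i, j ≤ l the operator A_{i,j} is the zero operator if i−j+1 < 0 and otherwise A_{i,j} := ([(i−j+1)κ + (j−1)δ]/[iδ]) · D_{m,r}^{(i−j+1)}, with D_{m,r}^{(0)} the identity operator. -/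

import Mathlib

open Finset

/-- Shifted factorial `[x; a]_k` for `k ∈ ℤ`:
`[x; a]_k = [x][x+a]⋯[x+(k-1)a]` for `k ≥ 0` and `[x; a]_{-k} = 1/[x-ka; a]_k`. -/
noncomputable def sfac (br : ℂ → ℂ) (a x : ℂ) (k : ℤ) : ℂ :=
  if 0 ≤ k then ∏ i ∈ Finset.range k.toNat, br (x + (i : ℂ) * a)
  else (∏ i ∈ Finset.range (-k).toNat, br (x + ((k : ℂ) + (i : ℂ)) * a))⁻¹

/-- The coefficient `C_{μ,I}(x; y; a, b)`. -/
noncomputable def Coef (br : ℂ → ℂ) (a b : ℂ) {m r : ℕ} (μ : Fin m → ℕ)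
    (I : Finset (Fin r)) (x : Fin m → ℂ) (y : Fin r → ℂ) : ℂ :=
  (-1 : ℂ) ^ I.card
    * (∏ i : Fin m, ∏ j : Fin m,
        if i < j then br (x i - x j + ((μ i : ℂ) - (μ j : ℂ)) * a) / br (x i - x j) else 1)
    * (∏ i ∈ I, ∏ j ∈ Iᶜ, br (y i - y j - a) / br (y i - y j))
    * (∏ i : Fin m, ∏ j : Fin m,
        sfac br a (x i - x j + b) (μ i : ℤ) / sfac br a (x i - x j + a) (μ i : ℤ))
    * ∏ i : Fin m,
        ((∏ j ∈ I, br (x i - y j - b) / br (x i - y j + (μ i : ℂ) * a))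
          * ∏ j ∈ Iᶜ, br (x i - y j - a) / br (x i - y j + ((μ i : ℂ) - 1) * a))

/-- Index set of the sums: pairs `(μ, I)` with `μ ∈ ℤ_{≥0}^m`, `I ⊆ {1,…,r}`, `|μ|+|I| = k`. -/
def idxSet (m r k : ℕ) : Finset ((Fin m → ℕ) × Finset (Fin r)) :=
  ((Fintype.piFinset fun _ : Fin m => Finset.range (k + 1)) ×ˢ
      (Finset.univ : Finset (Finset (Fin r)))).filter
    fun p => (∑ i, p.1 i) + p.2.card = k

def xshift (c : ℂ) {m : ℕ} (μ : Fin m → ℕ) (x : Fin m → ℂ) : Fin m → ℂ :=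
  fun i => x i + c * (μ i : ℂ)

def xshiftI (c : ℂ) {m : ℕ} (I : Finset (Fin m)) (x : Fin m → ℂ) : Fin m → ℂ :=
  fun i => x i + c * (if i ∈ I then 1 else 0)

def yshift (c : ℂ) {r : ℕ} (I : Finset (Fin r)) (y : Fin r → ℂ) : Fin r → ℂ :=
  fun j => y j - c * (if j ∈ I then 1 else 0)

def yshiftMu (c : ℂ) {r : ℕ} (μ : Fin r → ℕ) (y : Fin r → ℂ) : Fin r → ℂ :=
  fun j => y j - c * (μ j : ℂ)

/-- The deformed elliptic Ruijsenaars operator `H_{m,r}^{(k)}`. -/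
noncomputable def Hop (br : ℂ → ℂ) (δ κ : ℂ) (m r k : ℕ)
    (F : (Fin m → ℂ) → (Fin r → ℂ) → ℂ) (x : Fin m → ℂ) (y : Fin r → ℂ) : ℂ :=
  ∑ p ∈ idxSet m r k, Coef br δ κ p.1 p.2 x y * F (xshift δ p.1 x) (yshift κ p.2 y)

/-- The operator `D_{m,r}^{(k)}`. -/
noncomputable def Dop (br : ℂ → ℂ) (δ κ : ℂ) (m r k : ℕ)
    (F : (Fin m → ℂ) → (Fin r → ℂ) → ℂ) (x : Fin m → ℂ) (y : Fin r → ℂ) : ℂ :=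
  ∑ p ∈ idxSet r m k, Coef br (-κ) (-δ) p.1 p.2 y x * F (xshiftI δ p.2 x) (yshiftMu κ p.1 y)

/-- The operator `Ĥ_{m,r}^{(k)}`. -/
noncomputable def Hhat (br : ℂ → ℂ) (δ κ : ℂ) (m r k : ℕ)
    (F : (Fin m → ℂ) → (Fin r → ℂ) → ℂ) (x : Fin m → ℂ) (y : Fin r → ℂ) : ℂ :=
  ∑ p ∈ idxSet m r k,
    Coef br (-δ) (-κ) p.1 p.2 (fun i => x i - δ) (fun j => y j + κ)
      * F (xshift (-δ) p.1 x) (yshift (-κ) p.2 y)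

/-- The operator `D̂_{m,r}^{(k)}`. -/
noncomputable def Dhat (br : ℂ → ℂ) (δ κ : ℂ) (m r k : ℕ)
    (F : (Fin m → ℂ) → (Fin r → ℂ) → ℂ) (x : Fin m → ℂ) (y : Fin r → ℂ) : ℂ :=
  ∑ p ∈ idxSet r m k,
    Coef br κ δ p.1 p.2 (fun j => y j + κ) (fun i => x i - δ)
      * F (xshiftI (-δ) p.2 x) (yshiftMu (-κ) p.1 y)

/-- Nonvanishing of all bracket values occurring in denominators of `C_{μ,I}(x; y; a, b)`. -/
def CDenomNZ (br : ℂ → ℂ) (a : ℂ) {m r : ℕ} (μ : Fin m → ℕ)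
    (I : Finset (Fin r)) (x : Fin m → ℂ) (y : Fin r → ℂ) : Prop :=
  (∀ i j : Fin m, i < j → br (x i - x j) ≠ 0)
    ∧ (∀ i ∈ I, ∀ j ∈ Iᶜ, br (y i - y j) ≠ 0)
    ∧ (∀ i j : Fin m, sfac br a (x i - x j + a) (μ i : ℤ) ≠ 0)
    ∧ (∀ i : Fin m, ∀ j ∈ I, br (x i - y j + (μ i : ℂ) * a) ≠ 0)
    ∧ (∀ i : Fin m, ∀ j ∈ Iᶜ, br (x i - y j + ((μ i : ℂ) - 1) * a) ≠ 0)

/-- The operator `A_{i,j}` (with 1-based indices `i, j`): the zero operator if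
`i - j + 1 < 0`, and otherwise `([(i-j+1)κ + (j-1)δ]/[iδ]) · D_{m,r}^{(i-j+1)}`,
with `D_{m,r}^{(0)}` the identity operator. -/
noncomputable def Aop (br : ℂ → ℂ) (δ κ : ℂ) (m r : ℕ) (i j : ℕ)
    (F : (Fin m → ℂ) → (Fin r → ℂ) → ℂ) : (Fin m → ℂ) → (Fin r → ℂ) → ℂ :=
  if j ≤ i + 1 then
    fun x y =>
      (br (((i + 1 - j : ℕ) : ℂ) * κ + ((j : ℂ) - 1) * δ) / br ((i : ℂ) * δ))
        * (if i + 1 - j = 0 then F x y else Dop br δ κ m r (i + 1 - j) F x y)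
  else fun _ _ => 0

/-- The composition `A_{1,σ(1)} ∘ A_{2,σ(2)} ∘ ⋯ ∘ A_{l,σ(l)}` applied to `F`. -/
noncomputable def detComp (br : ℂ → ℂ) (δ κ : ℂ) (m r l : ℕ) (σ : Equiv.Perm (Fin l))
    (F : (Fin m → ℂ) → (Fin r → ℂ) → ℂ) : (Fin m → ℂ) → (Fin r → ℂ) → ℂ :=
  (List.ofFn fun i : Fin l => Aop br δ κ m r (i.1 + 1) ((σ i).1 + 1)).foldr
    (fun A G => A G) F


/-- The standing hypotheses on the bracket: odd, entire, not identically zero and satisfying the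
three-term relation. -/
structure IsBracket (br : ℂ → ℂ) : Prop where
  odd : ∀ z : ℂ, br (-z) = -br z
  entire : Differentiable ℂ br
  ne_zero : br ≠ 0
  three_term : ∀ a b c d : ℂ,
    br (a + b) * br (a - b) * br (c + d) * br (c - d)
      + br (a + d) * br (a - d) * br (b + c) * br (b - c)
      = br (a + c) * br (a - c) * br (b + d) * br (b - d)

namespace IsBracket

variable {br : ℂ → ℂ}

theorem map_zero (hb : IsBracket br) : br 0 = 0 := by
  have h := hb.odd 0
  rw [neg_zero] at h
  linear_combination h / 2

theorem sub_comm (hb : IsBracket br) (z w : ℂ) : br (z - w) = -br (w - z) := by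
  rw [← hb.odd, neg_sub]

theorem continuous (hb : IsBracket br) : Continuous br := hb.entire.continuous

theorem eventually_affine_ne_zero (hb : IsBracket br) (α β : ℂ) (hβ : β ≠ 0) :
    ∀ᶠ h in nhdsWithin (0 : ℂ) {0}ᶜ, br (α + β * h) ≠ 0 := by
  have hd : Differentiable ℂ fun h => br (α + β * h) :=
    hb.entire.comp ((differentiable_const α).add (differentiable_id.const_mul β))
  have ha : AnalyticOnNhd ℂ (fun h => br (α + β * h)) Set.univ :=
    hd.differentiableOn.analyticOnNhd isOpen_univ
  rcases (ha 0 (Set.mem_univ _)).eventually_eq_zero_or_eventually_ne_zero with h | h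
  · exfalso
    have h0 := ha.eqOn_zero_of_preconnected_of_eventuallyEq_zero isPreconnected_univ
      (Set.mem_univ 0) h
    apply hb.ne_zero
    funext z
    have hz := h0 (Set.mem_univ ((z - α) / β))
    simpa [mul_div_cancel₀, hβ, mul_div_assoc'] using hz
  · exact h

theorem eq_zero_of_eventually {f : ℂ → ℂ} (hf : Continuous f)
    (h : ∀ᶠ z in nhdsWithin (0 : ℂ) {0}ᶜ, f z = 0) : f 0 = 0 := by
  have h1 : Filter.Tendsto f (nhdsWithin (0 : ℂ) {0}ᶜ) (nhds (f 0)) :=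
    hf.continuousAt.mono_left nhdsWithin_le_nhds
  exact tendsto_nhds_unique_of_eventuallyEq h1 tendsto_const_nhds h

/-- The three-term relation as two-point interpolation. -/
theorem interpolate (hb : IsBracket br) (z z₁ z₂ a a' : ℂ) :
    br (z₁ - z₂) * br (z₁ + z₂ - a - a') * (br (z - a) * br (z - a'))
      = br (z₁ - a) * br (z₁ - a') * (br (z - (a + a' - z₂)) * br (z - z₂))
        - br (z₂ - a) * br (z₂ - a') * (br (z - (a + a' - z₁)) * br (z - z₁)) := by
  have h := hb.three_term (z - (a + a') / 2) (z₁ - (a + a') / 2) (z₂ - (a + a') / 2)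
    ((a - a') / 2)
  ring_nf at h ⊢
  linear_combination h

theorem sum_div_erase {S : Finset ℂ} (hb : IsBracket br)
    (hS : ∀ z ∈ S, ∀ w ∈ S, z ≠ w → br (z - w) ≠ 0) {z₂ : ℂ} (h₂ : z₂ ∈ S) (Q : ℂ → ℂ) :
    ∑ z ∈ S, Q z * br (z - z₂) / ∏ w ∈ S.erase z, br (z - w)
      = ∑ z ∈ S.erase z₂, Q z / ∏ w ∈ (S.erase z₂).erase z, br (z - w) := by
  rw [← Finset.sum_erase_add _ _ h₂]
  simp only [sub_self, hb.map_zero, mul_zero, zero_div, add_zero]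
  refine Finset.sum_congr rfl fun z hz => ?_
  have hz' := Finset.mem_erase.1 hz
  have hm : z₂ ∈ S.erase z := Finset.mem_erase.2 ⟨hz'.1.symm, h₂⟩
  rw [← Finset.mul_prod_erase _ _ hm, Finset.erase_right_comm, mul_comm (Q z),
    mul_div_mul_left _ _ (hS z hz'.2 z₂ h₂ hz'.1)]

/-- Partial fraction identity for the bracket. -/
theorem partial_fraction (hb : IsBracket br) (n : ℕ) :
    ∀ (S : Finset ℂ) (A : Multiset ℂ), S.card = n → A.card = n → ∑ z ∈ S, z = A.sum →
      (∀ z ∈ S, ∀ w ∈ S, z ≠ w → br (z - w) ≠ 0) →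
      ∑ z ∈ S, (A.map fun a => br (z - a)).prod / ∏ w ∈ S.erase z, br (z - w) = 0 := by
  induction n with
  | zero =>
    intro S A hS _ _ _
    rw [Finset.card_eq_zero.1 hS, Finset.sum_empty]
  | succ n ih =>
    intro S A hS hA hsum hne
    match n, ih with
    | 0, _ =>
      obtain ⟨z, rfl⟩ := Finset.card_eq_one.1 hS
      obtain ⟨a, rfl⟩ := Multiset.card_eq_one.1 hA
      simp only [Finset.sum_singleton, Multiset.sum_singleton] at hsum
      simp [hsum, hb.map_zero]
    | 1, _ =>
      obtain ⟨z, w, hzw, rfl⟩ := Finset.card_eq_two.1 hS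
      obtain ⟨a, c, rfl⟩ := Multiset.card_eq_two.1 hA
      rw [Finset.sum_pair hzw] at hsum ⊢
      have e1 : ({z, w} : Finset ℂ).erase z = {w} := by
        ext t; simp only [Finset.mem_erase, Finset.mem_insert, Finset.mem_singleton]; grind
      have e2 : ({z, w} : Finset ℂ).erase w = {z} := by
        ext t; simp only [Finset.mem_erase, Finset.mem_insert, Finset.mem_singleton]; grind
      have hs : z + w = a + c := by simpa using hsum
      have hz := hne z (by simp) w (by simp) hzw
      have e3 : w - a = -(z - c) := by linear_combination hs
      have e4 : w - c = -(z - a) := by linear_combination hs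
      simp only [e1, e2, Finset.prod_singleton, Multiset.insert_eq_cons, Multiset.map_cons,
        Multiset.map_singleton, Multiset.prod_cons, Multiset.prod_singleton, e3, e4, hb.odd,
        hb.sub_comm w z]
      field_simp
      ring
    | k + 2, ih =>
      obtain ⟨a, A₁, rfl, hA₁⟩ := Multiset.card_eq_succ_iff.1 hA
      obtain ⟨a', A₂, rfl, hA₂⟩ := Multiset.card_eq_succ_iff.1 hA₁
      obtain ⟨c, B, rfl, hB⟩ := Multiset.card_eq_succ_iff.1 hA₂
      obtain ⟨z₁, h₁, z₂, h₂, h₁₂⟩ := Finset.one_lt_card.1 (by omega : 1 < S.card)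
      simp only [Multiset.sum_cons] at hsum
      have key : ∀ h : ℂ, br (z₁ + z₂ - (a + h) - a') *
          ∑ z ∈ S, (((a + h) ::ₘ a' ::ₘ (c - h) ::ₘ B).map fun a => br (z - a)).prod
            / ∏ w ∈ S.erase z, br (z - w) = 0 := by
        intro h
        have hsub : ∀ u ∈ S, ∑ z ∈ S, (((a + h + a' - u) ::ₘ (c - h) ::ₘ B).map
            fun a => br (z - a)).prod * br (z - u) / ∏ w ∈ S.erase z, br (z - w) = 0 := by
          intro u hu
          rw [hb.sum_div_erase hne hu]
          refine ih _ _ ?_ ?_ ?_ ?_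
          · rw [Finset.card_erase_of_mem hu, hS]; omega
          · simp only [Multiset.card_cons]; omega
          · have := Finset.add_sum_erase S (fun z => z) hu
            simp only [Multiset.sum_cons]
            linear_combination this + hsum
          · intro z hz w hw
            exact hne z (Finset.mem_of_mem_erase hz) w (Finset.mem_of_mem_erase hw)
        apply mul_left_cancel₀ (hne z₁ h₁ z₂ h₂ h₁₂)
        rw [mul_zero, ← mul_assoc, Finset.mul_sum]
        have e := congrArg₂ (fun s t => br (z₁ - (a + h)) * br (z₁ - a') * s
          - br (z₂ - (a + h)) * br (z₂ - a') * t) (hsub z₂ h₂) (hsub z₁ h₁)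
        simp only [mul_zero, sub_zero, Finset.mul_sum] at e
        rw [← Finset.sum_sub_distrib] at e
        rw [← e]
        refine Finset.sum_congr rfl fun z _ => ?_
        have hi := hb.interpolate z z₁ z₂ (a + h) a'
        simp only [Multiset.map_cons, Multiset.prod_cons]
        linear_combination ((br (z - (c - h)) * (B.map fun a => br (z - a)).prod)
          / ∏ w ∈ S.erase z, br (z - w)) * hi
      have hc : Continuous fun h : ℂ =>
          ∑ z ∈ S, (((a + h) ::ₘ a' ::ₘ (c - h) ::ₘ B).map fun a => br (z - a)).prod
            / ∏ w ∈ S.erase z, br (z - w) := by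
        simp only [Multiset.map_cons, Multiset.prod_cons]
        have := hb.continuous
        fun_prop
      have h0 := eq_zero_of_eventually hc (by
        filter_upwards [hb.eventually_affine_ne_zero (z₁ + z₂ - a - a') (-1) (by norm_num)]
          with h hh
        refine (mul_eq_zero.1 (key h)).resolve_left ?_
        rwa [show z₁ + z₂ - (a + h) - a' = z₁ + z₂ - a - a' + -1 * h by ring])
      simpa using h0

/-- A summand of the subset identity `subsetSum_eq_zero`. -/
noncomputable def subsetTerm {ι : Type*} [DecidableEq ι] (br : ℂ → ℂ) (ε : ℂ) (X : ι → ℂ)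
    (S : Finset ι) (A : Multiset ℂ) (J : Finset ι) : ℂ :=
  (-1 : ℂ) ^ J.card * br (∑ i ∈ S, X i - A.sum + J.card * ε)
    * (∏ i ∈ J, ∏ j ∈ S \ J, br (X i - X j + ε) / br (X i - X j))
    * (∏ i ∈ J, (A.map fun w => br (X i - w)).prod)
    * ∏ i ∈ S \ J, (A.map fun w => br (X i - w + ε)).prod

section subset

variable {ι : Type*} [DecidableEq ι] {X : ι → ℂ} {S : Finset ι} {k : ι} {J : Finset ι}

theorem subsetTerm_of_mem (hb : IsBracket br) (ε : ℂ) (B : Multiset ℂ) (hkJ : k ∈ J) :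
    subsetTerm br ε X S (X k ::ₘ B) J = 0 := by
  have : (∏ i ∈ J, ((X k ::ₘ B).map fun w => br (X i - w)).prod) = 0 :=
    Finset.prod_eq_zero hkJ (by simp [hb.map_zero])
  rw [subsetTerm, this]
  ring

theorem subsetTerm_of_notMem (hb : IsBracket br) (ε : ℂ) (B : Multiset ℂ) (hkS : k ∈ S)
    (hkJ : k ∉ J) : subsetTerm br ε X S ((X k + ε) ::ₘ B) J = 0 := by
  have : (∏ i ∈ S \ J, (((X k + ε) ::ₘ B).map fun w => br (X i - w + ε)).prod) = 0 :=
    Finset.prod_eq_zero (Finset.mem_sdiff.2 ⟨hkS, hkJ⟩) (by simp [hb.map_zero])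
  rw [subsetTerm, this]
  ring

theorem subsetTerm_insert_left (ε : ℂ) (B : Multiset ℂ) (hkS : k ∉ S)
    (hJS : J ⊆ S) (hX : ∀ i ∈ S, br (X i - X k) ≠ 0) :
    subsetTerm br ε X (insert k S) (X k ::ₘ B) J
      = br ε * (B.map fun w => br (X k - w + ε)).prod * (∏ i ∈ S, br (X i - X k + ε))
        * subsetTerm br ε X S B J := by
  have hkJ : k ∉ J := fun h => hkS (hJS h)
  have e : insert k S \ J = insert k (S \ J) := Finset.insert_sdiff_of_notMem _ hkJ
  have hk' : k ∉ S \ J := fun h => hkS (Finset.mem_sdiff.1 h).1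
  have e1 : (∏ i ∈ J, ∏ j ∈ insert k (S \ J), br (X i - X j + ε) / br (X i - X j))
      * (∏ i ∈ J, br (X i - X k))
      = (∏ i ∈ J, br (X i - X k + ε)) * ∏ i ∈ J, ∏ j ∈ S \ J,
        br (X i - X j + ε) / br (X i - X j) := by
    rw [← Finset.prod_mul_distrib, ← Finset.prod_mul_distrib]
    refine Finset.prod_congr rfl fun i hi => ?_
    rw [Finset.prod_insert hk']
    have := hX i (hJS hi)
    field_simp
  have e2 := Finset.prod_sdiff hJS (f := fun i => br (X i - X k + ε))
  unfold subsetTerm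
  rw [e, Finset.prod_insert hk', Finset.sum_insert hkS]
  simp only [Multiset.map_cons, Multiset.prod_cons, Multiset.sum_cons, sub_self, zero_add,
    Finset.prod_mul_distrib]
  rw [show X k + ∑ i ∈ S, X i - (X k + B.sum) = ∑ i ∈ S, X i - B.sum by ring, ← e2]
  linear_combination (-1 : ℂ) ^ J.card * br (∑ i ∈ S, X i - B.sum + J.card * ε)
    * (∏ i ∈ J, (B.map fun w => br (X i - w)).prod)
    * (∏ i ∈ S \ J, (B.map fun w => br (X i - w + ε)).prod)
    * (br ε * (B.map fun w => br (X k - w + ε)).prod * ∏ i ∈ S \ J, br (X i - X k + ε)) * e1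

theorem subsetTerm_insert_right (hb : IsBracket br) (ε : ℂ) (B : Multiset ℂ) (hkS : k ∉ S)
    (hJS : J ⊆ S) (hX : ∀ i ∈ S, br (X k - X i) ≠ 0) :
    subsetTerm br ε X (insert k S) ((X k + ε) ::ₘ B) (insert k J)
      = br ε * (B.map fun w => br (X k - w)).prod * (∏ i ∈ S, br (X i - X k - ε))
        * subsetTerm br ε X S B J := by
  have hkJ : k ∉ J := fun h => hkS (hJS h)
  have e : insert k S \ insert k J = S \ J := by
    ext t; simp only [Finset.mem_sdiff, Finset.mem_insert]; grind
  have e1 : (∏ j ∈ S \ J, br (X k - X j + ε) / br (X k - X j))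
      * (∏ i ∈ S \ J, br (X i - X k)) = ∏ i ∈ S \ J, br (X i - X k - ε) := by
    rw [← Finset.prod_mul_distrib]
    refine Finset.prod_congr rfl fun i hi => ?_
    have := hX i (Finset.mem_sdiff.1 hi).1
    rw [hb.sub_comm (X i) (X k), show X i - X k - ε = -(X k - X i + ε) by ring, hb.odd]
    field_simp
  have e2 := Finset.prod_sdiff hJS (f := fun i => br (X i - X k - ε))
  unfold subsetTerm
  rw [e, Finset.prod_insert hkJ, Finset.prod_insert hkJ, Finset.sum_insert hkS,
    Finset.card_insert_of_notMem hkJ]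
  simp only [Multiset.map_cons, Multiset.prod_cons, Multiset.sum_cons, Finset.prod_mul_distrib]
  have e3 : ∀ i, X i - (X k + ε) + ε = X i - X k := fun i => by ring
  have e4 : ∀ i, X i - (X k + ε) = X i - X k - ε := fun i => by ring
  simp only [e3]
  simp only [e4]
  rw [show X k + ∑ i ∈ S, X i - (X k + ε + B.sum) + ((J.card + 1 : ℕ) : ℂ) * ε
      = ∑ i ∈ S, X i - B.sum + J.card * ε by push_cast; ring, ← e2, sub_self, zero_sub, hb.odd]
  linear_combination (-1 : ℂ) ^ J.card * br (∑ i ∈ S, X i - B.sum + J.card * ε)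
    * (∏ i ∈ J, (B.map fun w => br (X i - w)).prod)
    * (∏ i ∈ S \ J, (B.map fun w => br (X i - w + ε)).prod)
    * (∏ i ∈ J, ∏ j ∈ S \ J, br (X i - X j + ε) / br (X i - X j))
    * (br ε * (B.map fun w => br (X k - w)).prod * ∏ i ∈ J, br (X i - X k - ε)) * e1

theorem subsetSum_generic (hb : IsBracket br) (ε : ℂ) (B : Multiset ℂ) (v : ℂ)
    (hX : ∀ i ∈ S, ∀ j ∈ S, i ≠ j → br (X i - X j) ≠ 0)
    (hleft : ∀ i ∈ S, ∑ J ∈ S.powerset, subsetTerm br ε X S (X i ::ₘ B) J = 0)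
    (hright : ∑ J ∈ S.powerset, subsetTerm br ε X S ((X k + ε) ::ₘ B) J = 0)
    (h₁ : ∀ i ∈ S, br (v - X i) ≠ 0) (h₂ : br (v - (X k + ε)) ≠ 0)
    (h₃ : ∀ i ∈ S, br (X k + ε - X i) ≠ 0)
    (h₄ : br (∑ i ∈ S, X i - B.sum + S.card * ε - (X k + ε)) ≠ 0) :
    ∑ J ∈ S.powerset, subsetTerm br ε X S (v ::ₘ B) J = 0 := by
  set p := X k + ε with hp
  set g : ℂ → ℂ := fun z => ∑ J ∈ S.powerset, subsetTerm br ε X S (z ::ₘ B) J with hg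
  set P : Finset ℂ := insert v (insert p (S.image X)) with hP
  have hinj : Set.InjOn X S := fun i hi j hj hij => by
    by_contra hne
    exact hX i hi j hj hne (by rw [hij, sub_self, hb.map_zero])
  have hpS : p ∉ S.image X := fun h => by
    obtain ⟨i, hi, hip⟩ := Finset.mem_image.1 h
    exact h₃ i hi (by rw [hip, sub_self, hb.map_zero])
  have hvP : v ∉ insert p (S.image X) := fun h => by
    rcases Finset.mem_insert.1 h with h | h
    · exact h₂ (by rw [h, sub_self, hb.map_zero])
    · obtain ⟨i, hi, hip⟩ := Finset.mem_image.1 h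
      exact h₁ i hi (by rw [hip, sub_self, hb.map_zero])
  have hsym : ∀ z w, br (z - w) ≠ 0 → br (w - z) ≠ 0 := fun z w h => by
    rw [hb.sub_comm]; exact neg_ne_zero.2 h
  have hPne : ∀ z ∈ P, ∀ w ∈ P, z ≠ w → br (z - w) ≠ 0 := by
    intro z hz w hw hzw
    simp only [hP, Finset.mem_insert, Finset.mem_image] at hz hw
    rcases hz with rfl | rfl | ⟨i, hi, rfl⟩ <;> rcases hw with rfl | rfl | ⟨j, hj, rfl⟩
    · exact absurd rfl hzw
    · exact h₂
    · exact h₁ j hj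
    · exact hsym _ _ h₂
    · exact absurd rfl hzw
    · exact h₃ j hj
    · exact hsym _ _ (h₁ i hi)
    · exact hsym _ _ (h₃ i hi)
    · exact hX i hi j hj fun h => hzw (by rw [h])
  set a' : ℂ := v + p - ∑ i ∈ S, X i + B.sum - S.card * ε with ha'
  have hJ : ∀ J ∈ S.powerset, ∑ z ∈ P, subsetTerm br ε X S (z ::ₘ B) J * br (z - a')
      / ∏ w ∈ P.erase z, br (z - w) = 0 := by
    intro J hJS
    rw [Finset.mem_powerset] at hJS
    set A : Multiset ℂ := (∑ i ∈ S, X i - B.sum + J.card * ε) ::ₘ a' ::ₘ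
      (J.val.map X + (S \ J).val.map fun i => X i + ε) with hA
    have hcJ := Finset.card_sdiff_add_card_eq_card hJS
    have hpf := hb.partial_fraction (S.card + 2) P A
      (by rw [hP, Finset.card_insert_of_notMem hvP, Finset.card_insert_of_notMem hpS,
            Finset.card_image_of_injOn hinj])
      (by simp only [hA, Multiset.card_cons, Multiset.card_add, Multiset.card_map,
            Finset.card_val]; omega)
      (by
        rw [hP, Finset.sum_insert hvP, Finset.sum_insert hpS, Finset.sum_image hinj]
        simp only [hA, Multiset.sum_cons, Multiset.sum_add]
        change _ = _ + (_ + ((∑ i ∈ J, X i) + ∑ i ∈ S \ J, (X i + ε)))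
        rw [Finset.sum_add_distrib, Finset.sum_const, nsmul_eq_mul]
        have h1 := Finset.sum_sdiff hJS (f := X)
        have h2 : ((S \ J).card : ℂ) + J.card = S.card := by exact_mod_cast hcJ
        rw [ha', ← h2]
        linear_combination -h1)
      hPne
    have hrw : ∀ z ∈ P, subsetTerm br ε X S (z ::ₘ B) J * br (z - a')
        / ∏ w ∈ P.erase z, br (z - w)
        = ((-1) ^ J.card * (∏ i ∈ J, ∏ j ∈ S \ J, br (X i - X j + ε) / br (X i - X j))
            * (∏ i ∈ J, (B.map fun w => br (X i - w)).prod)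
            * (∏ i ∈ S \ J, (B.map fun w => br (X i - w + ε)).prod)
            * ((-1) * (-1) ^ J.card * (-1) ^ (S \ J).card))
          * ((A.map fun a => br (z - a)).prod / ∏ w ∈ P.erase z, br (z - w)) := by
      intro z _
      have hAz : (A.map fun a => br (z - a)).prod
          = br (z - (∑ i ∈ S, X i - B.sum + J.card * ε)) * (br (z - a')
            * ((∏ i ∈ J, br (z - X i)) * ∏ i ∈ S \ J, br (z - (X i + ε)))) := by
        simp only [hA, Multiset.map_cons, Multiset.prod_cons, Multiset.map_add,
          Multiset.prod_add, Multiset.map_map]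
        rfl
      have s1 : ∏ i ∈ J, br (X i - z) = (-1) ^ J.card * ∏ i ∈ J, br (z - X i) := by
        rw [← Finset.prod_const, ← Finset.prod_mul_distrib]
        exact Finset.prod_congr rfl fun i _ => by rw [hb.sub_comm]; ring
      have s2 : ∏ i ∈ S \ J, br (X i - z + ε)
          = (-1) ^ (S \ J).card * ∏ i ∈ S \ J, br (z - (X i + ε)) := by
        rw [← Finset.prod_const, ← Finset.prod_mul_distrib]
        refine Finset.prod_congr rfl fun i _ => ?_
        rw [show X i - z + ε = X i + ε - z by ring, hb.sub_comm]; ring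
      rw [hAz, subsetTerm]
      simp only [Multiset.map_cons, Multiset.prod_cons, Multiset.sum_cons,
        Finset.prod_mul_distrib]
      rw [s1, s2, show ∑ i ∈ S, X i - (z + B.sum) + J.card * ε
        = (∑ i ∈ S, X i - B.sum + J.card * ε) - z by ring, hb.sub_comm _ z]
      ring
    rw [Finset.sum_congr rfl hrw, ← Finset.mul_sum, hpf, mul_zero]
  have hsum : ∑ z ∈ P, g z * br (z - a') / ∏ w ∈ P.erase z, br (z - w) = 0 := by
    rw [← Finset.sum_eq_zero hJ, Finset.sum_comm]
    refine Finset.sum_congr rfl fun z _ => ?_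
    rw [hg, Finset.sum_mul, Finset.sum_div]
  have hgS : ∑ z ∈ S.image X, g z * br (z - a') / ∏ w ∈ P.erase z, br (z - w) = 0 := by
    refine Finset.sum_eq_zero fun z hz => ?_
    obtain ⟨i, hi, rfl⟩ := Finset.mem_image.1 hz
    rw [show g (X i) = 0 from hleft i hi, zero_mul, zero_div]
  rw [hP, Finset.sum_insert hvP, Finset.sum_insert hpS, ← hP, hgS,
    show g p = 0 from hright, zero_mul, zero_div, add_zero, add_zero] at hsum
  have hprod : ∏ w ∈ P.erase v, br (v - w) ≠ 0 := Finset.prod_ne_zero_iff.2 fun w hw =>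
    hPne v (Finset.mem_insert_self _ _) w (Finset.mem_of_mem_erase hw)
      (Finset.mem_erase.1 hw).1.symm
  have h5 : br (v - a') ≠ 0 := by
    rw [ha', show v - (v + p - ∑ i ∈ S, X i + B.sum - S.card * ε)
      = ∑ i ∈ S, X i - B.sum + S.card * ε - p by ring]
    exact h₄
  exact (mul_eq_zero.1 ((div_eq_zero_iff.1 hsum).resolve_right hprod)).resolve_right h5

/-- The subset identity underlying the Wronski relations. -/
theorem subsetSum_eq_zero (hb : IsBracket br) (n : ℕ) :
    ∀ (S : Finset ι) (A : Multiset ℂ) (ε : ℂ), S.card = n → A.card = n →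
      (∀ i ∈ S, ∀ j ∈ S, i ≠ j → br (X i - X j) ≠ 0) →
      ∑ J ∈ S.powerset, subsetTerm br ε X S A J = 0 := by
  induction n with
  | zero =>
    intro S A ε hS hA _
    rw [Finset.card_eq_zero.1 hS, Multiset.card_eq_zero.1 hA]
    simp [subsetTerm, hb.map_zero]
  | succ n ih =>
    intro S A ε hS hA hX
    match n, ih with
    | 0, _ =>
      obtain ⟨k, rfl⟩ := Finset.card_eq_one.1 hS
      obtain ⟨a, rfl⟩ := Multiset.card_eq_one.1 hA
      rw [show ({k} : Finset ι) = insert k ∅ by simp, Finset.sum_powerset_insert (by simp)]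
      simp [subsetTerm]
      ring
    | n + 1, ih =>
      obtain ⟨v, A₁, rfl, hA₁⟩ := Multiset.card_eq_succ_iff.1 hA
      obtain ⟨b, B, rfl, hB⟩ := Multiset.card_eq_succ_iff.1 hA₁
      obtain ⟨k, hk⟩ : S.Nonempty := Finset.card_pos.1 (by omega)
      have hred : ∀ i ∈ S, ∀ (C : Multiset ℂ) (η : ℂ), C.card = n + 1 →
          ∑ J ∈ (S.erase i).powerset, subsetTerm br η X (S.erase i) C J = 0 := by
        intro i hi C η hC
        refine ih _ _ _ ?_ hC ?_
        · rw [Finset.card_erase_of_mem hi, hS]; omega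
        · intro j hj j' hj'
          exact hX j (Finset.mem_of_mem_erase hj) j' (Finset.mem_of_mem_erase hj')
      have hleft : ∀ i ∈ S, ∀ (C : Multiset ℂ) (η : ℂ), C.card = n + 1 →
          ∑ J ∈ S.powerset, subsetTerm br η X S (X i ::ₘ C) J = 0 := by
        intro i hi C η hC
        have hi' : i ∉ S.erase i := Finset.notMem_erase i S
        rw [← Finset.insert_erase hi, Finset.sum_powerset_insert hi']
        rw [Finset.sum_congr rfl fun J hJ => subsetTerm_insert_left η C hi'
            (Finset.mem_powerset.1 hJ) fun j hj => hX j (Finset.mem_of_mem_erase hj) i hi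
              (Finset.mem_erase.1 hj).1,
          ← Finset.mul_sum, hred i hi C η hC, mul_zero, zero_add]
        exact Finset.sum_eq_zero fun J _ =>
          hb.subsetTerm_of_mem η C (Finset.mem_insert_self i J)
      have hright : ∀ i ∈ S, ∀ (C : Multiset ℂ) (η : ℂ), C.card = n + 1 →
          ∑ J ∈ S.powerset, subsetTerm br η X S ((X i + η) ::ₘ C) J = 0 := by
        intro i hi C η hC
        have hi' : i ∉ S.erase i := Finset.notMem_erase i S
        rw [← Finset.insert_erase hi, Finset.sum_powerset_insert hi']
        rw [Finset.sum_eq_zero fun J hJ => hb.subsetTerm_of_notMem η C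
            (Finset.mem_insert_self i _) fun h => hi' (Finset.mem_powerset.1 hJ h), zero_add]
        rw [Finset.sum_congr rfl fun J hJ => hb.subsetTerm_insert_right η C hi'
            (Finset.mem_powerset.1 hJ) fun j hj => hX i hi j (Finset.mem_of_mem_erase hj)
              (Finset.mem_erase.1 hj).1.symm,
          ← Finset.mul_sum, hred i hi C η hC, mul_zero]
      have hc : Continuous fun h : ℂ => ∑ J ∈ S.powerset,
          subsetTerm br (ε + h) X S ((v + 2 * h) ::ₘ (b + (n + 2) * h) ::ₘ B) J := by
        unfold subsetTerm
        simp only [Multiset.map_cons, Multiset.prod_cons, Multiset.sum_cons]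
        have := hb.continuous
        have hm : ∀ i, Continuous fun h : ℂ => (B.map fun w => br (X i - w + (ε + h))).prod :=
          fun i => continuous_multiset_prod _ fun w _ => by fun_prop
        simp only [div_eq_mul_inv]
        fun_prop
      have h0 := eq_zero_of_eventually hc (by
        have q1 : ∀ᶠ h in nhdsWithin (0 : ℂ) {0}ᶜ, ∀ i ∈ S, br (v - X i + 2 * h) ≠ 0 :=
          (Filter.eventually_all_finset S).2 fun i _ =>
            hb.eventually_affine_ne_zero _ _ (by norm_num)
        have q3 : ∀ᶠ h in nhdsWithin (0 : ℂ) {0}ᶜ, ∀ i ∈ S,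
            br (X k + ε - X i + 1 * h) ≠ 0 :=
          (Filter.eventually_all_finset S).2 fun i _ =>
            hb.eventually_affine_ne_zero _ _ (by norm_num)
        filter_upwards [q1, hb.eventually_affine_ne_zero (v - (X k + ε)) 1 (by norm_num), q3,
          hb.eventually_affine_ne_zero
            (∑ i ∈ S, X i - (b + B.sum) + S.card * ε - (X k + ε)) (-1) (by norm_num)]
          with h g1 g2 g3 g4
        refine hb.subsetSum_generic (k := k) _ _ _ hX (fun i hi => hleft i hi _ _ ?_)
          (hright k hk _ _ ?_) (fun i hi => ?_) ?_ (fun i hi => ?_) ?_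
        · simp [hB]
        · simp [hB]
        · rw [show v + 2 * h - X i = v - X i + 2 * h by ring]; exact g1 i hi
        · rw [show v + 2 * h - (X k + (ε + h)) = v - (X k + ε) + 1 * h by ring]; exact g2
        · rw [show X k + (ε + h) - X i = X k + ε - X i + 1 * h by ring]; exact g3 i hi
        · rw [Multiset.sum_cons, show ∑ i ∈ S, X i - (b + (n + 2) * h + B.sum)
              + S.card * (ε + h) - (X k + (ε + h))
              = ∑ i ∈ S, X i - (b + B.sum) + S.card * ε - (X k + ε) + -1 * h by
                rw [hS]; push_cast; ring]
          exact g4)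
      simpa using h0

end subset

end IsBracket

section products

variable {α β : Type*} [Fintype α] [Fintype β] [DecidableEq α] [DecidableEq β]

theorem prod_mem_mem (A : Finset α) (B : Finset β) (f : α → β → ℂ) :
    ∏ i ∈ A, ∏ j ∈ B, f i j = ∏ i, ∏ j, if i ∈ A ∧ j ∈ B then f i j else 1 := by
  rw [← Finset.prod_subset (Finset.subset_univ A)]
  · refine Finset.prod_congr rfl fun i hi => ?_
    rw [← Finset.prod_subset (Finset.subset_univ B)]
    · exact Finset.prod_congr rfl fun j hj => by rw [if_pos ⟨hi, hj⟩]
    · exact fun j _ hj => if_neg fun h => hj h.2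
  · exact fun i _ hi => Finset.prod_eq_one fun j _ => if_neg fun h => hi h.1

theorem prod_mem_mem_swap (A : Finset α) (B : Finset β) (f : α → β → ℂ) :
    ∏ i ∈ A, ∏ j ∈ B, f i j = ∏ j, ∏ i, if i ∈ A ∧ j ∈ B then f i j else 1 := by
  rw [prod_mem_mem, Finset.prod_comm]

theorem prod_mul_prod_compl_ite (A : Finset α) (f g : α → ℂ) :
    (∏ i ∈ A, f i) * ∏ i ∈ Aᶜ, g i = ∏ i, if i ∈ A then f i else g i := by
  rw [← Finset.prod_mul_prod_compl A fun i => if i ∈ A then f i else g i]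
  congr 1
  · exact Finset.prod_congr rfl fun i hi => by rw [if_pos hi]
  · exact Finset.prod_congr rfl fun i hi => by rw [if_neg (Finset.mem_compl.1 hi)]

theorem prod_prod_eq_prod_lt {m : ℕ} (G : Fin m → Fin m → ℂ) (hG : ∀ i, G i i = 1) :
    ∏ i, ∏ j, G i j = ∏ i, ∏ j, if i < j then G i j * G j i else 1 := by
  have h1 : ∀ i j, G i j = (if i < j then G i j else 1) * if j < i then G i j else 1 := by
    intro i j
    rcases lt_trichotomy i j with h | rfl | h
    · simp [h, h.asymm]
    · simp [hG]
    · simp [h, h.asymm]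
  have h2 : ∀ i j, (if i < j then G i j * G j i else 1)
      = (if i < j then G i j else 1) * if i < j then G j i else 1 := by
    intro i j
    split_ifs <;> simp
  simp only [h2, Finset.prod_mul_distrib]
  rw [Finset.prod_congr rfl fun i _ => Finset.prod_congr rfl fun j _ => h1 i j]
  simp only [Finset.prod_mul_distrib]
  congr 1
  rw [Finset.prod_comm]

end products

theorem sfac_natCast (br : ℂ → ℂ) (a z : ℂ) (k : ℕ) :
    sfac br a z (k : ℤ) = ∏ s ∈ Finset.range k, br (z + (s : ℂ) * a) := by
  simp [sfac]

theorem IsBracket.prod_lt_shift {br : ℂ → ℂ} (hb : IsBracket br) {m : ℕ} (z : Fin m → ℂ)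
    (c : ℂ) (J : Finset (Fin m)) (hz : ∀ i j, i ≠ j → br (z i - z j) ≠ 0) :
    (∏ i, ∏ j, if i < j then
        br (z i - z j - ((if i ∈ J then 1 else 0) - (if j ∈ J then 1 else 0)) * c)
          / br (z i - z j) else 1)
      = ∏ i ∈ J, ∏ j ∈ Jᶜ, br (z i - z j - c) / br (z i - z j) := by
  rw [prod_mem_mem J Jᶜ, prod_prod_eq_prod_lt
    (fun i j => if i ∈ J ∧ j ∈ Jᶜ then br (z i - z j - c) / br (z i - z j) else 1)
    (fun i => by simp)]
  refine Finset.prod_congr rfl fun i _ => Finset.prod_congr rfl fun j _ => ?_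
  by_cases hij : i < j
  · simp only [hij, if_true, Finset.mem_compl]
    have h1 := hz i j hij.ne
    by_cases hi : i ∈ J <;> by_cases hj : j ∈ J <;> simp [hi, hj, h1]
    rw [hb.sub_comm (z j) (z i), show z j - z i - c = -(z i - z j + c) by ring, hb.odd,
      neg_div_neg_eq]
  · simp [hij]

/-- `Coef` with the factors that cancel for `μ_i = 0` removed. -/
noncomputable def redCoef (br : ℂ → ℂ) (a b : ℂ) {m r : ℕ} (μ : Fin m → ℕ)
    (I : Finset (Fin r)) (x : Fin m → ℂ) (y : Fin r → ℂ) : ℂ :=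
  (-1 : ℂ) ^ I.card
    * (∏ i : Fin m, ∏ j : Fin m,
        if i < j then br (x i - x j + ((μ i : ℂ) - (μ j : ℂ)) * a) / br (x i - x j) else 1)
    * (∏ i ∈ I, ∏ j ∈ Iᶜ, br (y i - y j - a) / br (y i - y j))
    * (∏ i : Fin m, ∏ j : Fin m,
        sfac br a (x i - x j + b) (μ i : ℤ) / sfac br a (x i - x j + a) (μ i : ℤ))
    * ∏ i : Fin m,
        ((∏ j ∈ I, br (x i - y j - b) / br (x i - y j + (μ i : ℂ) * a))
          * ∏ j ∈ Iᶜ, if μ i = 0 then 1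
              else br (x i - y j - a) / br (x i - y j + ((μ i : ℂ) - 1) * a))

/-- The nonvanishing conditions on a base point used for the Wronski relation of order `l`. -/
structure Admissible (br : ℂ → ℂ) (δ κ : ℂ) {m r : ℕ} (x : Fin m → ℂ) (y : Fin r → ℂ)
    (l : ℕ) : Prop where
  delta : ∀ n : ℕ, 1 ≤ n → br ((n : ℂ) * δ) ≠ 0
  kappa : ∀ n : ℕ, 1 ≤ n → br ((n : ℂ) * κ) ≠ 0
  xx : ∀ i j, i ≠ j → ∀ a b : ℕ, a + b ≤ l → br (x i - x j + ((a : ℂ) - b) * δ) ≠ 0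
  yy : ∀ i j, i ≠ j → ∀ a b : ℕ, a + b ≤ l → br (y i - y j - ((a : ℂ) - b) * κ) ≠ 0
  xy : ∀ i j, ∀ a b : ℕ, a + b ≤ l → br (x i - y j + a * δ + b * κ) ≠ 0
  xy' : ∀ i j, ∀ a : ℕ, a ≤ l → br (x i - y j + a * δ - κ) ≠ 0

section pairs

variable (br : ℂ → ℂ) (δ κ : ℂ) {m r : ℕ} (x : Fin m → ℂ) (y : Fin r → ℂ) (n : Fin m → ℕ)
  (t : Fin r → ℕ) (J : Finset (Fin m)) (I : Finset (Fin r))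

/-- Indices with positive exponent. -/
def posSupp {m : ℕ} (n : Fin m → ℕ) : Finset (Fin m) := Finset.univ.filter fun i => 0 < n i

/-- The exponent vector `n - 1_J`. -/
def subInd {m : ℕ} (n : Fin m → ℕ) (J : Finset (Fin m)) : Fin m → ℕ :=
  fun i => n i - if i ∈ J then 1 else 0

/-- The `(x_i, x_j)`-factor of a product of two coefficients. -/
noncomputable def coefXX (i j : Fin m) : ℂ :=
  (if i < j then br (x i + δ * n i - (x j + δ * n j)) / br (x i - x j) else 1)
    * (if i ∈ J ∧ j ∈ Jᶜ then br (x i + δ * n i - (x j + δ * n j) + (κ - δ))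
        / br (x i + δ * n i - (x j + δ * n j)) else 1)
    * ((∏ s ∈ Finset.range (subInd n J i), br (x i - x j + κ + s * δ))
        / ∏ s ∈ Finset.range (subInd n J i), br (x i - x j + δ + s * δ))

/-- The `(x_i, x_j)`-factor of the subset identity. -/
noncomputable def pairXX (i j : Fin m) : ℂ :=
  (if i ∈ J ∧ j ∈ posSupp n \ J then br (x i + δ * n i - (x j + δ * n j) + (κ - δ))
      / br (x i + δ * n i - (x j + δ * n j)) else 1)
    * (if i ∈ J ∧ j ∈ posSupp n then br (x i + δ * n i - x j) else 1)
    * (if i ∈ posSupp n \ J ∧ j ∈ posSupp n then br (x i + δ * n i - x j + (κ - δ)) else 1)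

/-- The part of `coefXX` that does not depend on the subset. -/
noncomputable def constXX (i j : Fin m) : ℂ :=
  (if i < j then br (x i + δ * n i - (x j + δ * n j)) / br (x i - x j) else 1)
    * (if n i = 0 then 1
        else (∏ s ∈ Finset.range (if n j = 0 then n i else n i - 1), br (x i - x j + κ + s * δ))
          / ∏ s ∈ Finset.range (n i), br (x i - x j + δ + s * δ))

/-- The `(y_i, y_j)`-factor of a product of two coefficients. -/
noncomputable def coefYY (i j : Fin r) : ℂ :=
  (if i < j then br (y i - κ * t i - (y j - κ * t j)) / br (y i - y j) else 1)
    * (if i ∈ I ∧ j ∈ Iᶜ then br (y i - y j - δ) / br (y i - y j - κ) else 1)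
    * ((∏ s ∈ Finset.range (subInd t I i),
          br (yshift κ I y i - yshift κ I y j + -δ + s * -κ))
        / ∏ s ∈ Finset.range (subInd t I i),
          br (yshift κ I y i - yshift κ I y j + -κ + s * -κ))

/-- The factor of the subset identity matched with the pair `(y_i, y_j)`. -/
noncomputable def pairYY (i j : Fin r) : ℂ :=
  (if i ∈ posSupp t \ I ∧ j ∈ I then br (y i + δ - (y j + δ) + (κ - δ))
      / br (y i + δ - (y j + δ)) else 1)
    * (if j ∈ posSupp t \ I ∧ i ∈ posSupp t then
        br (y j + δ - (y i - κ * t i + κ)) else 1)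
    * (if j ∈ I ∧ i ∈ posSupp t then br (y j + δ - (y i - κ * t i + κ) + (κ - δ)) else 1)

/-- The part of `coefYY` that does not depend on the subset. -/
noncomputable def constYY (i j : Fin r) : ℂ :=
  (if i < j then br (y i - κ * t i - (y j - κ * t j)) / br (y i - y j) else 1)
    * (if t i = 0 then 1
        else (if t j = 0 then 1 else -1) *
          ((∏ s ∈ Finset.range (if t j = 0 then t i else t i - 1), br (y i - y j - δ + s * -κ))
          / ∏ s ∈ Finset.range (t i), br (y i - y j - κ + s * -κ)))

/-- The `(x_i, y_j)`-factor of a product of two coefficients. -/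
noncomputable def coefXY (i : Fin m) (j : Fin r) : ℂ :=
  (if j ∈ I then br (x i - y j - κ) / br (x i - y j + (subInd n J i : ℂ) * δ)
    else if subInd n J i = 0 then 1
      else br (x i - y j - δ) / br (x i - y j + ((subInd n J i : ℂ) - 1) * δ))
    * (if i ∈ J then br (yshift κ I y j - xshift δ (subInd n J) x i - -δ)
          / br (yshift κ I y j - xshift δ (subInd n J) x i + (subInd t I j : ℂ) * -κ)
        else br (yshift κ I y j - xshift δ (subInd n J) x i - -κ)
          / br (yshift κ I y j - xshift δ (subInd n J) x i + ((subInd t I j : ℂ) - 1) * -κ))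

/-- The factor of the subset identity matched with the pair `(x_i, y_j)`. -/
noncomputable def pairXY (i : Fin m) (j : Fin r) : ℂ :=
  (if i ∈ J ∧ j ∈ I then br (x i + δ * n i - (y j + δ) + (κ - δ))
      / br (x i + δ * n i - (y j + δ)) else 1)
    * (if j ∈ posSupp t \ I ∧ i ∈ posSupp n \ J then br (y j + δ - (x i + δ * n i) + (κ - δ))
      / br (y j + δ - (x i + δ * n i)) else 1)
    * (if i ∈ J ∧ j ∈ posSupp t then br (x i + δ * n i - (y j - κ * t j + κ)) else 1)
    * (if i ∈ posSupp n \ J ∧ j ∈ posSupp t then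
        br (x i + δ * n i - (y j - κ * t j + κ) + (κ - δ)) else 1)
    * (if j ∈ posSupp t \ I ∧ i ∈ posSupp n then br (y j + δ - x i) else 1)
    * (if j ∈ I ∧ i ∈ posSupp n then br (y j + δ - x i + (κ - δ)) else 1)

/-- The part of `coefXY` that does not depend on the subset. -/
noncomputable def constXY (i : Fin m) (j : Fin r) : ℂ :=
  if n i = 0 then br (x i - y j - κ) / br (x i + δ * n i - (y j - κ * t j) - κ)
  else if t j = 0 then br (x i - y j - δ) / br (x i + δ * n i - y j - δ)
  else -1 / (br (x i + δ * n i - (y j - κ * t j) - κ)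
    * br (x i + δ * n i - (y j - κ * t j) - δ))

end pairs

section matching

variable {br : ℂ → ℂ} {δ κ : ℂ} {m r : ℕ} {x : Fin m → ℂ} {y : Fin r → ℂ} {n : Fin m → ℕ}
  {t : Fin r → ℕ} {J : Finset (Fin m)} {I : Finset (Fin r)} {l : ℕ}

theorem mem_posSupp {m : ℕ} {n : Fin m → ℕ} {i : Fin m} : i ∈ posSupp n ↔ 0 < n i := by
  simp [posSupp]

theorem coefXX_eq (had : Admissible br δ κ x y l) (hJ : J ⊆ posSupp n)
    (hn : ∀ i, n i ≤ l) (i j : Fin m) :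
    coefXX br δ κ x n J i j = constXX br δ κ x n i j * pairXX br δ κ x n J i j := by
  have hden : ∀ s < n i, br (x i - x j + δ + s * δ) ≠ 0 := by
    intro s hs
    by_cases hij : i = j
    · subst hij
      convert had.delta (s + 1) (by omega) using 2
      push_cast; ring
    · convert had.xx i j hij (s + 1) 0 (by have := hn i; omega) using 2
      push_cast; ring
  unfold coefXX constXX pairXX
  rw [mul_assoc, mul_assoc]
  congr 1
  have hJi : i ∈ J → 0 < n i := fun h => mem_posSupp.1 (hJ h)
  have hJj : j ∈ J → 0 < n j := fun h => mem_posSupp.1 (hJ h)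
  rcases Nat.eq_zero_or_pos (n i) with h0 | h0
  · have hi : i ∉ J := fun h => by have := hJi h; omega
    simp [hi, h0, subInd, mem_posSupp]
  obtain ⟨k, hk⟩ : ∃ k, n i = k + 1 := ⟨n i - 1, by omega⟩
  have hq := hden k (by omega)
  have hQ : (∏ s ∈ Finset.range k, br (x i - x j + δ + s * δ)) ≠ 0 :=
    Finset.prod_ne_zero_iff.2 fun s hs => hden s (by have := Finset.mem_range.1 hs; omega)
  have e1 : br (x i + δ * ((k : ℂ) + 1) - x j) = br (x i - x j + δ + k * δ) := by
    congr 1; ring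
  have e2 : br (x i + δ * ((k : ℂ) + 1) - x j + (κ - δ)) = br (x i - x j + κ + k * δ) := by
    congr 1; ring
  generalize hqe : br (x i - x j + δ + k * δ) = q at hq e1
  generalize hpe : br (x i - x j + κ + k * δ) = p at e2
  generalize hQe : (∏ s ∈ Finset.range k, br (x i - x j + δ + s * δ)) = Q at hQ
  generalize hPe : (∏ s ∈ Finset.range k, br (x i - x j + κ + s * δ)) = P
  rcases Nat.eq_zero_or_pos (n j) with h1 | h1
  · have hj : j ∉ J := fun h => by have := hJj h; omega
    by_cases hi : i ∈ J
    · simp [hi, hj, hk, h1, subInd, mem_posSupp, Finset.prod_range_succ, e1, e2, hqe, hpe,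
        hQe, hPe]
      field_simp
    · simp [hi, hk, h1, subInd, mem_posSupp]
  · have h1' : n j ≠ 0 := by omega
    by_cases hi : i ∈ J <;> by_cases hj : j ∈ J <;>
    · simp [hi, hj, hk, h1, h1', subInd, mem_posSupp, Finset.prod_range_succ, e1, e2, hqe, hpe,
        hQe, hPe]
      field_simp

theorem prod_range_shift (br : ℂ → ℂ) (κ c : ℂ) (k : ℕ) :
    ∏ s ∈ Finset.range (k + 1), br (c + κ + s * -κ)
      = br (c + κ) * ∏ s ∈ Finset.range k, br (c + s * -κ) := by
  rw [Finset.prod_range_succ', mul_comm]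
  congr 1
  · simp
  · exact Finset.prod_congr rfl fun s _ => by congr 1; push_cast; ring

theorem coefYY_eq (hb : IsBracket br) (had : Admissible br δ κ x y l) (hI : I ⊆ posSupp t)
    (ht : ∀ i, t i ≤ l) (i j : Fin r) :
    coefYY br δ κ y t I i j = constYY br δ κ y t i j * pairYY br δ κ y t I i j := by
  have hden : ∀ s < t i, br (y i - y j - κ + s * -κ) ≠ 0 := by
    intro s hs
    by_cases hij : i = j
    · subst hij
      have h := had.kappa (s + 1) (by omega)
      rw [show y i - y i - κ + s * -κ = -(((s + 1 : ℕ) : ℂ) * κ) by push_cast; ring, hb.odd]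
      exact neg_ne_zero.2 h
    · convert had.yy i j hij (s + 1) 0 (by have := ht i; omega) using 2
      push_cast; ring
  have hd : i ≠ j → br (y i - y j) ≠ 0 := fun hij => by
    simpa using had.yy i j hij 0 0 (by omega)
  unfold coefYY constYY pairYY
  rw [mul_assoc, mul_assoc]
  congr 1
  have hIi : i ∈ I → 0 < t i := fun h => mem_posSupp.1 (hI h)
  have hIj : j ∈ I → 0 < t j := fun h => mem_posSupp.1 (hI h)
  rcases Nat.eq_zero_or_pos (t i) with h0 | h0
  · have hi : i ∉ I := fun h => by have := hIi h; omega
    simp [hi, h0, subInd, mem_posSupp]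
  obtain ⟨k, hk⟩ : ∃ k, t i = k + 1 := ⟨t i - 1, by omega⟩
  have hm := hden k (by omega)
  have hM : (∏ s ∈ Finset.range k, br (y i - y j - κ + s * -κ)) ≠ 0 :=
    Finset.prod_ne_zero_iff.2 fun s hs => hden s (by have := Finset.mem_range.1 hs; omega)
  have hM' : (∏ s ∈ Finset.range (k + 1), br (y i - y j - κ + s * -κ)) ≠ 0 :=
    Finset.prod_ne_zero_iff.2 fun s hs => hden s (by have := Finset.mem_range.1 hs; omega)
  have hdκ : br (y i - y j - κ) ≠ 0 := by simpa using hden 0 (by omega)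
  have e1 : br (y j + δ - (y i - κ * ((k + 1 : ℕ) : ℂ) + κ)) = -br (y i - y j - δ + k * -κ) := by
    rw [← hb.odd]; congr 1; push_cast; ring
  have e2 : br (y j + δ - (y i - κ * ((k + 1 : ℕ) : ℂ) + κ) + (κ - δ))
      = -br (y i - y j - κ + k * -κ) := by
    rw [← hb.odd]; congr 1; push_cast; ring
  have e3 : y i + δ - (y j + δ) = y i - y j := by ring
  have hN1 := Finset.prod_range_succ (fun s : ℕ => br (y i - y j - δ + s * -κ)) k
  have hM1 := Finset.prod_range_succ (fun s : ℕ => br (y i - y j - κ + s * -κ)) k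
  have hN2 := prod_range_shift br κ (y i - y j - δ - κ) k
  have hM2 := prod_range_shift br κ (y i - y j - κ - κ) k
  have hN3 := prod_range_shift br κ (y i - y j - δ) k
  have hM3 := prod_range_shift br κ (y i - y j - κ) k
  rw [sub_add_cancel] at hN2 hM2 hM3
  rw [hN1] at hN2
  rw [hM1] at hM2
  rw [hM1] at hM'
  rw [hk, e1, e2, e3, hM1]
  have hsucc : ¬ (k + 1 = 0) := by omega
  have hi' : i ∈ posSupp t := mem_posSupp.2 h0
  generalize hme : br (y i - y j - κ + k * -κ) = mk at *
  generalize hne : br (y i - y j - δ + k * -κ) = nk at *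
  generalize hMe : (∏ s ∈ Finset.range k, br (y i - y j - κ + s * -κ)) = M at *
  generalize hNe : (∏ s ∈ Finset.range k, br (y i - y j - δ + s * -κ)) = N at *
  rcases Nat.eq_zero_or_pos (t j) with h1 | h1
  · have hj : j ∉ I := fun h => by have := hIj h; omega
    have hj' : j ∉ posSupp t := fun h => by have := mem_posSupp.1 h; omega
    by_cases hi : i ∈ I
    · have hs : subInd t I i = k := by simp [subInd, hi, hk]
      simp only [hs, yshift, hi, hj, hj', hi', h1, hsucc, if_true, if_false, Finset.mem_compl,
        Finset.mem_sdiff, not_true, not_false_iff, and_true, and_false, false_and, hN1]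
      rw [show y i - κ * 1 - (y j - κ * 0) + -δ = y i - y j - δ - κ by ring,
        show y i - κ * 1 - (y j - κ * 0) + -κ = y i - y j - κ - κ by ring, hM2, hN2]
      have : (∏ s ∈ Finset.range k, br (y i - y j - κ - κ + s * -κ)) ≠ 0 := fun h => by
        rw [h, mul_zero] at hM2; exact hM' hM2
      generalize br (y i - y j - κ) = u at *
      generalize (∏ s ∈ Finset.range k, br (y i - y j - κ - κ + s * -κ)) = v at *
      generalize (∏ s ∈ Finset.range k, br (y i - y j - δ - κ + s * -κ)) = w at *
      generalize br (y i - y j - δ) = u' at *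
      field_simp
    · have hs : subInd t I i = k + 1 := by simp [subInd, hi, hk]
      simp only [hs, yshift, hi, hj, hj', hi', h1, hsucc, if_true, if_false, Finset.mem_compl,
        Finset.mem_sdiff, not_true, not_false_iff, and_true, and_false, false_and]
      rw [show y i - κ * 0 - (y j - κ * 0) + -δ = y i - y j - δ by ring,
        show y i - κ * 0 - (y j - κ * 0) + -κ = y i - y j - κ by ring, hM1]
      ring
  · have h1' : ¬ t j = 0 := by omega
    have hj' : j ∈ posSupp t := mem_posSupp.2 h1
    by_cases hi : i ∈ I <;> by_cases hj : j ∈ I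
    · have hs : subInd t I i = k := by simp [subInd, hi, hk]
      simp only [hs, yshift, hi, hj, hj', hi', h1', hsucc, if_true, if_false, Finset.mem_compl,
        Finset.mem_sdiff, not_true, not_false_iff, and_true, and_false, false_and,
        Nat.add_sub_cancel]
      rw [show y i - κ * 1 - (y j - κ * 1) + -δ = y i - y j - δ by ring,
        show y i - κ * 1 - (y j - κ * 1) + -κ = y i - y j - κ by ring, hMe, hNe]
      field_simp
    · have hs : subInd t I i = k := by simp [subInd, hi, hk]
      simp only [hs, yshift, hi, hj, hj', hi', h1', hsucc, if_true, if_false, Finset.mem_compl,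
        Finset.mem_sdiff, not_true, not_false_iff, and_true, and_false, false_and,
        Nat.add_sub_cancel]
      rw [show y i - κ * 1 - (y j - κ * 0) + -δ = y i - y j - δ - κ by ring,
        show y i - κ * 1 - (y j - κ * 0) + -κ = y i - y j - κ - κ by ring, hM2, hNe]
      have : (∏ s ∈ Finset.range k, br (y i - y j - κ - κ + s * -κ)) ≠ 0 := fun h => by
        rw [h, mul_zero] at hM2; exact hM' hM2
      generalize br (y i - y j - κ) = u at *
      generalize (∏ s ∈ Finset.range k, br (y i - y j - κ - κ + s * -κ)) = v at *
      generalize (∏ s ∈ Finset.range k, br (y i - y j - δ - κ + s * -κ)) = w at *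
      generalize br (y i - y j - δ) = u' at *
      field_simp
      rw [← hN2]
    · have hij : i ≠ j := fun h => hi (h ▸ hj)
      have hs : subInd t I i = k + 1 := by simp [subInd, hi, hk]
      simp only [hs, yshift, hi, hj, hj', hi', h1', hsucc, if_true, if_false, Finset.mem_compl,
        Finset.mem_sdiff, not_true, not_false_iff, and_true, and_false, false_and,
        Nat.add_sub_cancel]
      rw [show y i - κ * 0 - (y j - κ * 1) + -δ = y i - y j - δ + κ by ring,
        show y i - κ * 0 - (y j - κ * 1) + -κ = y i - y j by ring, hM3, hN3, hNe,
        show y i - y j + (κ - δ) = y i - y j - δ + κ by ring]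
      have hd' := hd hij
      generalize br (y i - y j) = u at *
      generalize br (y i - y j - δ + κ) = v at *
      field_simp
    · have hs : subInd t I i = k + 1 := by simp [subInd, hi, hk]
      simp only [hs, yshift, hi, hj, hj', hi', h1', hsucc, if_true, if_false, Finset.mem_compl,
        Finset.mem_sdiff, not_true, not_false_iff, and_true, and_false, false_and,
        Nat.add_sub_cancel]
      rw [show y i - κ * 0 - (y j - κ * 0) + -δ = y i - y j - δ by ring,
        show y i - κ * 0 - (y j - κ * 0) + -κ = y i - y j - κ by ring, hM1, hN1, hNe]
      ring

theorem coefXY_eq (hb : IsBracket br) (had : Admissible br δ κ x y l) (hJ : J ⊆ posSupp n)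
    (hI : I ⊆ posSupp t) (hnt : ∀ i j, n i + t j ≤ l) (i : Fin m) (j : Fin r) :
    coefXY br δ κ x y n t J I i j = constXY br δ κ x y n t i j * pairXY br δ κ x y n t J I i j := by
  have hJi : i ∈ J → 0 < n i := fun h => mem_posSupp.1 (hJ h)
  have hIj : j ∈ I → 0 < t j := fun h => mem_posSupp.1 (hI h)
  have hl := hnt i j
  have ne : ∀ (a b : ℕ) (z : ℂ), a + b ≤ l → z = x i - y j + a * δ + b * κ → br z ≠ 0 :=
    fun a b z h hz => hz ▸ had.xy i j a b h
  have ne' : ∀ (a : ℕ) (z : ℂ), a ≤ l → z = x i - y j + a * δ - κ → br z ≠ 0 :=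
    fun a z h hz => hz ▸ had.xy' i j a h
  unfold coefXY constXY pairXY
  rcases Nat.eq_zero_or_pos (n i) with h0 | h0
  · have hi : i ∉ J := fun h => by have := hJi h; omega
    have hi' : i ∉ posSupp n := fun h => by have := mem_posSupp.1 h; omega
    have hμ : subInd n J i = 0 := by simp [subInd, hi, h0]
    have hX : xshift δ (subInd n J) x i = x i := by simp [xshift, hμ]
    by_cases hj : j ∈ I
    · obtain ⟨q, hq⟩ : ∃ q, t j = q + 1 := ⟨t j - 1, by have := hIj hj; omega⟩
      have hν : subInd t I j = q := by simp [subInd, hj, hq]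
      have hY : yshift κ I y j = y j - κ := by simp [yshift, hj]
      rw [hX, hY, hν, hμ, hq, h0]
      simp only [hi, hi', hj, if_true, if_false, and_true, and_false, false_and, true_and,
        Finset.mem_sdiff, not_true, not_false_iff]
      rw [show y j - κ - x i - -κ = -(x i - y j) by ring,
        show y j - κ - x i + ((q : ℂ) - 1) * -κ = -(x i - y j + q * κ) by ring,
        show x i - y j + ((0 : ℕ) : ℂ) * δ = x i - y j by simp,
        show x i + δ * ((0 : ℕ) : ℂ) - (y j - κ * ((q + 1 : ℕ) : ℂ)) - κ = x i - y j + q * κ by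
          push_cast; ring, hb.odd, hb.odd]
      have h1 := ne 0 0 (x i - y j) (by omega) (by simp)
      generalize br (x i - y j) = u at *
      generalize br (x i - y j - κ) = u' at *
      generalize br (x i - y j + q * κ) = v at *
      field_simp
    · have hY : yshift κ I y j = y j := by simp [yshift, hj]
      have hν : subInd t I j = t j := by simp [subInd, hj]
      rw [hX, hY, hν, hμ, h0]
      simp only [hi, hi', hj, if_true, if_false, and_true, and_false, false_and, true_and,
        Finset.mem_sdiff, not_true, not_false_iff]
      rw [show y j - x i - -κ = -(x i - y j - κ) by ring,
        show y j - x i + ((t j : ℂ) - 1) * -κ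
          = -(x i + δ * ((0 : ℕ) : ℂ) - (y j - κ * t j) - κ) by push_cast; ring, hb.odd, hb.odd,
        neg_div_neg_eq]
      ring
  obtain ⟨k, hk⟩ : ∃ k, n i = k + 1 := ⟨n i - 1, by omega⟩
  have hi' : i ∈ posSupp n := mem_posSupp.2 h0
  have hk0 : ¬ (k + 1 = 0) := by omega
  rcases Nat.eq_zero_or_pos (t j) with h1 | h1
  · have hj : j ∉ I := fun h => by have := hIj h; omega
    have hj' : j ∉ posSupp t := fun h => by have := mem_posSupp.1 h; omega
    have hY : yshift κ I y j = y j := by simp [yshift, hj]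
    have hν : subInd t I j = 0 := by simp [subInd, hj, h1]
    by_cases hi : i ∈ J
    · have hμ : subInd n J i = k := by simp [subInd, hi, hk]
      have hX : xshift δ (subInd n J) x i = x i + δ * k := by simp [xshift, hμ]
      rw [hX, hY, hν, hμ, hk, h1]
      simp only [hi, hi', hj, hj', hk0, if_true, if_false, and_true, and_false, false_and,
        true_and, Finset.mem_sdiff, not_true, not_false_iff]
      rw [show y j - (x i + δ * k) - -δ = -(x i - y j + ((k : ℂ) - 1) * δ) by ring,
        show y j - (x i + δ * k) + ((0 : ℕ) : ℂ) * -κ = -(x i - y j + k * δ) by push_cast; ring,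
        show x i + δ * ((k + 1 : ℕ) : ℂ) - y j - δ = x i - y j + k * δ by push_cast; ring,
        hb.odd, hb.odd, neg_div_neg_eq]
      by_cases hk1 : k = 0
      · subst hk1
        simp [← sub_eq_add_neg]
      · have h3 := ne (k - 1) 0 (x i - y j + ((k : ℂ) - 1) * δ) (by omega) (by
          rw [Nat.cast_sub (by omega)]; push_cast; ring)
        have h4 := ne k 0 (x i - y j + k * δ) (by omega) (by push_cast; ring)
        rw [if_neg hk1]
        generalize br (x i - y j + ((k : ℂ) - 1) * δ) = u at *
        generalize br (x i - y j + k * δ) = v at *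
        generalize br (x i - y j - δ) = w at *
        field_simp
    · have hμ : subInd n J i = k + 1 := by simp [subInd, hi, hk]
      have hX : xshift δ (subInd n J) x i = x i + δ * (k + 1) := by simp [xshift, hμ]
      rw [hX, hY, hν, hμ, hk, h1]
      simp only [hi, hi', hj, hj', hk0, if_true, if_false, and_true, and_false, false_and,
        true_and, Finset.mem_sdiff, not_true, not_false_iff]
      rw [show y j - (x i + δ * (k + 1)) + (((0 : ℕ) : ℂ) - 1) * -κ
          = -(x i - y j + ((k + 1 : ℕ) : ℂ) * δ - κ) by push_cast; ring,
        show y j - (x i + δ * (k + 1)) - -κ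
          = -(x i - y j + ((k + 1 : ℕ) : ℂ) * δ - κ) by push_cast; ring,
        hb.odd, neg_div_neg_eq, div_self (ne' (k + 1) _ (by omega) rfl),
        show x i - y j + (((k + 1 : ℕ) : ℂ) - 1) * δ = x i + δ * ((k + 1 : ℕ) : ℂ) - y j - δ by
          ring]
      ring
  obtain ⟨q, hq⟩ : ∃ q, t j = q + 1 := ⟨t j - 1, by omega⟩
  have hj' : j ∈ posSupp t := mem_posSupp.2 h1
  have hq0 : ¬ (q + 1 = 0) := by omega
  have hA := ne (k + 1) q (x i - y j + (k + 1) * δ + q * κ) (by omega) (by push_cast; ring)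
  have hB := ne k (q + 1) (x i - y j + k * δ + (q + 1) * κ) (by omega) (by push_cast; ring)
  have hC := ne k 0 (x i - y j + k * δ) (by omega) (by push_cast; ring)
  have hE := ne (k + 1) 0 (x i - y j + (k + 1) * δ) (by omega) (by push_cast; ring)
  rw [hk, hq]
  have c1 : br (x i + δ * ((k + 1 : ℕ) : ℂ) - (y j - κ * ((q + 1 : ℕ) : ℂ)) - κ)
      = br (x i - y j + (k + 1) * δ + q * κ) := by congr 1; push_cast; ring
  have c2 : br (x i + δ * ((k + 1 : ℕ) : ℂ) - (y j - κ * ((q + 1 : ℕ) : ℂ)) - δ)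
      = br (x i - y j + k * δ + (q + 1) * κ) := by congr 1; push_cast; ring
  have c3 : br (x i + δ * ((k + 1 : ℕ) : ℂ) - (y j - κ * ((q + 1 : ℕ) : ℂ) + κ))
      = br (x i - y j + (k + 1) * δ + q * κ) := by congr 1; push_cast; ring
  have c4 : br (x i + δ * ((k + 1 : ℕ) : ℂ) - (y j - κ * ((q + 1 : ℕ) : ℂ) + κ) + (κ - δ))
      = br (x i - y j + k * δ + (q + 1) * κ) := by congr 1; push_cast; ring
  have c5 : br (y j + δ - x i) = -br (x i - y j - δ) := by rw [← hb.odd]; congr 1; ring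
  have c6 : br (y j + δ - x i + (κ - δ)) = -br (x i - y j - κ) := by
    rw [← hb.odd]; congr 1; ring
  have c7 : br (x i + δ * ((k + 1 : ℕ) : ℂ) - (y j + δ)) = br (x i - y j + k * δ) := by
    congr 1; push_cast; ring
  have c8 : br (x i + δ * ((k + 1 : ℕ) : ℂ) - (y j + δ) + (κ - δ))
      = br (x i - y j + ((k : ℂ) - 1) * δ + κ) := by
    congr 1; push_cast; ring
  have c9 : br (y j + δ - (x i + δ * ((k + 1 : ℕ) : ℂ))) = -br (x i - y j + k * δ) := by
    rw [← hb.odd]; congr 1; push_cast; ring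
  have c10 : br (y j + δ - (x i + δ * ((k + 1 : ℕ) : ℂ)) + (κ - δ))
      = -br (x i - y j + (k + 1) * δ - κ) := by
    rw [← hb.odd]; congr 1; push_cast; ring
  rw [c1, c2, c3, c4, c5, c6, c7, c8, c9, c10]
  clear c1 c2 c3 c4 c5 c6 c7 c8 c9 c10
  by_cases hi : i ∈ J <;> by_cases hj : j ∈ I
  · have hμ : subInd n J i = k := by simp [subInd, hi, hk]
    have hX : xshift δ (subInd n J) x i = x i + δ * k := by simp [xshift, hμ]
    have hν : subInd t I j = q := by simp [subInd, hj, hq]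
    have hY : yshift κ I y j = y j - κ := by simp [yshift, hj]
    rw [hX, hY, hν, hμ]
    simp only [hi, hi', hj, hj', hk0, hq0, if_true, if_false, and_true, and_false, false_and,
      true_and, Finset.mem_sdiff, not_true, not_false_iff]
    rw [show y j - κ - (x i + δ * k) - -δ = -(x i - y j + ((k : ℂ) - 1) * δ + κ) by ring,
      show y j - κ - (x i + δ * k) + q * -κ = -(x i - y j + k * δ + (q + 1) * κ) by ring,
      hb.odd, hb.odd]
    generalize br (x i - y j + k * δ + (q + 1) * κ) = B at *
    generalize br (x i - y j + (k + 1) * δ + q * κ) = A at *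
    generalize br (x i - y j + k * δ) = C at *
    generalize br (x i - y j + ((k : ℂ) - 1) * δ + κ) = E at *
    generalize br (x i - y j - κ) = G at *
    field_simp
  · have hμ : subInd n J i = k := by simp [subInd, hi, hk]
    have hX : xshift δ (subInd n J) x i = x i + δ * k := by simp [xshift, hμ]
    have hν : subInd t I j = q + 1 := by simp [subInd, hj, hq]
    have hY : yshift κ I y j = y j := by simp [yshift, hj]
    rw [hX, hY, hν, hμ]
    simp only [hi, hi', hj, hj', hk0, hq0, if_true, if_false, and_true, and_false, false_and,
      true_and, Finset.mem_sdiff, not_true, not_false_iff]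
    rw [show y j - (x i + δ * k) - -δ = -(x i - y j + ((k : ℂ) - 1) * δ) by ring,
      show y j - (x i + δ * k) + ((q + 1 : ℕ) : ℂ) * -κ = -(x i - y j + k * δ + (q + 1) * κ) by
        push_cast; ring, hb.odd, hb.odd]
    by_cases hk1 : k = 0
    · subst hk1
      simp only [if_true, Nat.cast_zero, zero_sub, zero_mul, add_zero, zero_add, neg_mul, one_mul,
        ← sub_eq_add_neg] at hA hB hC ⊢
      generalize br (x i - y j + (q + 1) * κ) = B at *
      generalize br (x i - y j + δ + q * κ) = A at *
      generalize br (x i - y j - δ) = G at *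
      field_simp
    · have h3 := ne (k - 1) 0 (x i - y j + ((k : ℂ) - 1) * δ) (by omega) (by
        rw [Nat.cast_sub (by omega)]; push_cast; ring)
      rw [if_neg hk1]
      generalize br (x i - y j + k * δ + (q + 1) * κ) = B at *
      generalize br (x i - y j + (k + 1) * δ + q * κ) = A at *
      generalize br (x i - y j + ((k : ℂ) - 1) * δ) = E at *
      generalize br (x i - y j - δ) = G at *
      field_simp
  · have hμ : subInd n J i = k + 1 := by simp [subInd, hi, hk]
    have hX : xshift δ (subInd n J) x i = x i + δ * (k + 1) := by simp [xshift, hμ]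
    have hν : subInd t I j = q := by simp [subInd, hj, hq]
    have hY : yshift κ I y j = y j - κ := by simp [yshift, hj]
    rw [hX, hY, hν, hμ]
    simp only [hi, hi', hj, hj', hk0, hq0, if_true, if_false, and_true, and_false, false_and,
      true_and, Finset.mem_sdiff, not_true, not_false_iff]
    rw [show y j - κ - (x i + δ * (k + 1)) - -κ = -(x i - y j + (k + 1) * δ) by ring,
      show y j - κ - (x i + δ * (k + 1)) + ((q : ℂ) - 1) * -κ
        = -(x i - y j + (k + 1) * δ + q * κ) by ring,
      show x i - y j + ((k + 1 : ℕ) : ℂ) * δ = x i - y j + (k + 1) * δ by push_cast; ring,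
      hb.odd, hb.odd]
    generalize br (x i - y j + k * δ + (q + 1) * κ) = B at *
    generalize br (x i - y j + (k + 1) * δ + q * κ) = A at *
    generalize br (x i - y j + (k + 1) * δ) = C at *
    generalize br (x i - y j - κ) = G at *
    field_simp
  · have hμ : subInd n J i = k + 1 := by simp [subInd, hi, hk]
    have hX : xshift δ (subInd n J) x i = x i + δ * (k + 1) := by simp [xshift, hμ]
    have hν : subInd t I j = q + 1 := by simp [subInd, hj, hq]
    have hY : yshift κ I y j = y j := by simp [yshift, hj]
    rw [hX, hY, hν, hμ]
    simp only [hi, hi', hj, hj', hk0, hq0, if_true, if_false, and_true, and_false, false_and,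
      true_and, Finset.mem_sdiff, not_true, not_false_iff]
    rw [show y j - (x i + δ * (k + 1)) - -κ = -(x i - y j + (k + 1) * δ - κ) by ring,
      show y j - (x i + δ * (k + 1)) + (((q + 1 : ℕ) : ℂ) - 1) * -κ
        = -(x i - y j + (k + 1) * δ + q * κ) by push_cast; ring,
      show x i - y j + (((k + 1 : ℕ) : ℂ) - 1) * δ = x i - y j + k * δ by push_cast; ring,
      hb.odd, hb.odd]
    generalize br (x i - y j + k * δ + (q + 1) * κ) = B at *
    generalize br (x i - y j + (k + 1) * δ + q * κ) = A at *
    generalize br (x i - y j + k * δ) = C at *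
    generalize br (x i - y j + (k + 1) * δ - κ) = E at *
    generalize br (x i - y j - δ) = G at *
    field_simp

end matching

section coefficientProduct

variable {br : ℂ → ℂ} {δ κ : ℂ} {m r : ℕ} {x : Fin m → ℂ} {y : Fin r → ℂ} {n : Fin m → ℕ}
  {t : Fin r → ℕ} {J : Finset (Fin m)} {I : Finset (Fin r)} {l : ℕ}

theorem subInd_cast (hJ : J ⊆ posSupp n) (i : Fin m) :
    (subInd n J i : ℂ) = n i - if i ∈ J then 1 else 0 := by
  by_cases hi : i ∈ J
  · have : 1 ≤ n i := mem_posSupp.1 (hJ hi)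
    simp [subInd, hi, Nat.cast_sub this]
  · simp [subInd, hi]

theorem prod_coefXX (hb : IsBracket br) (had : Admissible br δ κ x y l) (hJ : J ⊆ posSupp n)
    (hn : ∀ i j, i ≠ j → n i + n j ≤ l) :
    (∏ i : Fin m, ∏ j : Fin m, if i < j then
        br (x i - x j + ((subInd n J i : ℂ) - (subInd n J j : ℂ)) * δ) / br (x i - x j) else 1)
      * (∏ i ∈ J, ∏ j ∈ Jᶜ, br (xshift δ (subInd n J) x i - xshift δ (subInd n J) x j - -κ)
          / br (xshift δ (subInd n J) x i - xshift δ (subInd n J) x j))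
      * (∏ i : Fin m, ∏ j : Fin m, sfac br δ (x i - x j + κ) (subInd n J i : ℤ)
          / sfac br δ (x i - x j + δ) (subInd n J i : ℤ))
      = ∏ i, ∏ j, coefXX br δ κ x n J i j := by
  have hX : ∀ i j, i ≠ j → br (x i + δ * n i - (x j + δ * n j)) ≠ 0 := fun i j hij => by
    convert had.xx i j hij (n i) (n j) (hn i j hij) using 2
    ring
  simp only [coefXX, Finset.prod_mul_distrib, sfac_natCast]
  congr 1
  have hV : (∏ i : Fin m, ∏ j : Fin m, if i < j then
        br (x i - x j + ((subInd n J i : ℂ) - (subInd n J j : ℂ)) * δ) / br (x i - x j) else 1)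
      = (∏ i : Fin m, ∏ j : Fin m, if i < j then
          br (x i + δ * n i - (x j + δ * n j)) / br (x i - x j) else 1)
        * ∏ i ∈ J, ∏ j ∈ Jᶜ, br (x i + δ * n i - (x j + δ * n j) - δ)
          / br (x i + δ * n i - (x j + δ * n j)) := by
    rw [← hb.prod_lt_shift (fun i => x i + δ * n i) δ J hX]
    simp only [← Finset.prod_mul_distrib]
    refine Finset.prod_congr rfl fun i _ => Finset.prod_congr rfl fun j _ => ?_
    split_ifs with hij <;> try rw [mul_one]
    all_goals
      rw [mul_comm (_ / _), div_mul_div_cancel₀ (hX i j hij.ne), subInd_cast hJ, subInd_cast hJ]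
      congr 2
      simp [*]
      try ring
  rw [hV, mul_assoc, ← prod_mem_mem J Jᶜ]
  simp only [← Finset.prod_mul_distrib]
  congr 1
  refine Finset.prod_congr rfl fun i hi => Finset.prod_congr rfl fun j hj => ?_
  have hj' := Finset.mem_compl.1 hj
  have hij : i ≠ j := fun h => hj' (h ▸ hi)
  have hpos : 1 ≤ n i := mem_posSupp.1 (hJ hi)
  have e : xshift δ (subInd n J) x i - xshift δ (subInd n J) x j
      = x i + δ * n i - (x j + δ * n j) - δ := by
    simp only [xshift, subInd_cast hJ, hi, hj', if_true, if_false]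
    ring
  have hne : br (x i + δ * n i - (x j + δ * n j) - δ) ≠ 0 := by
    convert had.xx i j hij (n i - 1) (n j) (by have := hn i j hij; omega) using 2
    rw [Nat.cast_sub hpos]
    push_cast; ring
  rw [e, mul_comm, div_mul_div_cancel₀ hne]
  congr 2
  ring

theorem Admissible.yshift_sub_ne_zero (had : Admissible br δ κ x y l) (hl : ∀ i ∈ I, 1 ≤ l)
    {i j : Fin r} (hij : i ≠ j) : br (yshift κ I y i - yshift κ I y j) ≠ 0 := by
  have hY : br (y i - y j) ≠ 0 := by simpa using had.yy i j hij 0 0 (by omega)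
  by_cases hi : i ∈ I <;> by_cases hj : j ∈ I
  · simpa [yshift, hi, hj] using hY
  · convert had.yy i j hij 1 0 (hl i hi) using 2
    simp [yshift, hi, hj]; ring
  · convert had.yy i j hij 0 1 (hl j hj) using 2
    simp [yshift, hi, hj]; ring
  · simpa [yshift, hi, hj] using hY

theorem prod_coefYY (hb : IsBracket br) (had : Admissible br δ κ x y l) (hI : I ⊆ posSupp t)
    (ht : ∀ i, t i ≤ l) :
    (∏ i : Fin r, ∏ j : Fin r, if i < j then
        br (yshift κ I y i - yshift κ I y j + ((subInd t I i : ℂ) - (subInd t I j : ℂ)) * -κ)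
          / br (yshift κ I y i - yshift κ I y j) else 1)
      * (∏ i ∈ I, ∏ j ∈ Iᶜ, br (y i - y j - δ) / br (y i - y j))
      * (∏ i : Fin r, ∏ j : Fin r,
          sfac br (-κ) (yshift κ I y i - yshift κ I y j + -δ) (subInd t I i : ℤ)
          / sfac br (-κ) (yshift κ I y i - yshift κ I y j + -κ) (subInd t I i : ℤ))
      = ∏ i, ∏ j, coefYY br δ κ y t I i j := by
  have hY : ∀ i j, i ≠ j → br (y i - y j) ≠ 0 := fun i j hij => by
    simpa using had.yy i j hij 0 0 (by omega)
  have hl : ∀ i ∈ I, 1 ≤ l := fun i hi => (mem_posSupp.1 (hI hi)).trans_le (ht i)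
  have hκ : ∀ i ∈ I, ∀ j ∈ Iᶜ, br (y i - y j - κ) ≠ 0 := fun i hi j hj => by
    have hij : i ≠ j := fun h => Finset.mem_compl.1 hj (h ▸ hi)
    simpa using had.yy i j hij 1 0 (hl i hi)
  simp only [coefYY, Finset.prod_mul_distrib, sfac_natCast]
  congr 1
  rw [← prod_mem_mem I Iᶜ]
  have hP : (∏ i ∈ I, ∏ j ∈ Iᶜ, br (y i - y j - δ) / br (y i - y j))
      = (∏ i ∈ I, ∏ j ∈ Iᶜ, br (y i - y j - κ) / br (y i - y j))
        * ∏ i ∈ I, ∏ j ∈ Iᶜ, br (y i - y j - δ) / br (y i - y j - κ) := by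
    simp only [← Finset.prod_mul_distrib]
    refine Finset.prod_congr rfl fun i hi => Finset.prod_congr rfl fun j hj => ?_
    rw [mul_comm, div_mul_div_cancel₀ (hκ i hi j hj)]
  rw [hP, ← mul_assoc, ← hb.prod_lt_shift y κ I hY]
  simp only [← Finset.prod_mul_distrib]
  congr 1
  refine Finset.prod_congr rfl fun i _ => Finset.prod_congr rfl fun j _ => ?_
  by_cases hij : i < j
  · have e : y i - y j - ((if i ∈ I then 1 else 0) - (if j ∈ I then 1 else 0)) * κ
        = yshift κ I y i - yshift κ I y j := by simp only [yshift]; ring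
    rw [if_pos hij, if_pos hij, if_pos hij, e, div_mul_div_cancel₀ (had.yshift_sub_ne_zero hl hij.ne),
      subInd_cast hI, subInd_cast hI]
    congr 2
    simp only [yshift]
    ring
  · simp [hij]

theorem redCoef_mul_Coef (hb : IsBracket br) (had : Admissible br δ κ x y l)
    (hJ : J ⊆ posSupp n) (hI : I ⊆ posSupp t) (hn : ∀ i j, i ≠ j → n i + n j ≤ l)
    (ht : ∀ i, t i ≤ l) :
    redCoef br δ κ (subInd n J) I x y
        * Coef br (-κ) (-δ) (subInd t I) J (yshift κ I y) (xshift δ (subInd n J) x)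
      = (-1) ^ I.card * (-1) ^ J.card * (∏ i, ∏ j, coefXX br δ κ x n J i j)
        * (∏ i, ∏ j, coefXY br δ κ x y n t J I i j) * ∏ i, ∏ j, coefYY br δ κ y t I i j := by
  rw [← prod_coefXX hb had hJ hn, ← prod_coefYY hb had hI ht]
  simp only [coefXY, Finset.prod_mul_distrib]
  simp only [redCoef, Coef, prod_mul_prod_compl_ite]
  rw [Finset.prod_comm (s := (Finset.univ : Finset (Fin m))) (t := (Finset.univ : Finset (Fin r)))
    (f := fun i j => if i ∈ J then _ else _)]
  ring

end coefficientProduct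

section subsetIdentity

variable {br : ℂ → ℂ} {δ κ : ℂ} {m r : ℕ} {x : Fin m → ℂ} {y : Fin r → ℂ} {n : Fin m → ℕ}
  {t : Fin r → ℕ} {J : Finset (Fin m)} {I : Finset (Fin r)} {l : ℕ}

/-- The nodes of the subset identity. -/
noncomputable def nodeZ (δ : ℂ) (x : Fin m → ℂ) (y : Fin r → ℂ) (n : Fin m → ℕ) :
    Fin m ⊕ Fin r → ℂ :=
  Sum.elim (fun i => x i + δ * n i) fun j => y j + δ

/-- The free parameters of the subset identity. -/
noncomputable def nodeW (κ : ℂ) (x : Fin m → ℂ) (y : Fin r → ℂ) (t : Fin r → ℕ) :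
    Fin m ⊕ Fin r → ℂ :=
  Sum.elim x fun j => y j - κ * t j + κ

theorem sum_posSupp {m : ℕ} (n : Fin m → ℕ) : ∑ i ∈ posSupp n, (n i : ℂ) = ∑ i, (n i : ℂ) :=
  Finset.sum_subset (Finset.subset_univ _) fun i _ hi => by
    have : ¬ 0 < n i := fun h => hi (mem_posSupp.2 h)
    simp [Nat.eq_zero_of_not_pos this]

theorem sum_nodeZ_sub_nodeW (hI : I ⊆ posSupp t) :
    ∑ a ∈ (posSupp n).disjSum (posSupp t), nodeZ δ x y n a
        - (((posSupp n).disjSum (posSupp t)).val.map (nodeW κ x y t)).sum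
        + ((J.disjSum (posSupp t \ I)).card : ℂ) * (κ - δ)
      = (∑ j, (t j : ℂ) - I.card + J.card) * κ + (∑ i, (n i : ℂ) - J.card + I.card) * δ := by
  have h : (((posSupp n).disjSum (posSupp t)).val.map (nodeW κ x y t)).sum
      = ∑ a ∈ (posSupp n).disjSum (posSupp t), nodeW κ x y t a := rfl
  rw [h, ← sum_posSupp n, ← sum_posSupp t, Finset.card_disjSum, Finset.card_sdiff_of_subset hI,
    Nat.cast_add, Nat.cast_sub (Finset.card_le_card hI)]
  simp only [Finset.sum_disjSum, nodeZ, nodeW, Sum.elim_inl, Sum.elim_inr,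
    Finset.sum_add_distrib, Finset.sum_sub_distrib, ← Finset.mul_sum, Finset.sum_const,
    nsmul_eq_mul]
  ring

theorem subsetTerm_disjSum (hI : I ⊆ posSupp t) :
    IsBracket.subsetTerm br (κ - δ) (nodeZ δ x y n) ((posSupp n).disjSum (posSupp t))
        (((posSupp n).disjSum (posSupp t)).val.map (nodeW κ x y t)) (J.disjSum (posSupp t \ I))
      = (-1) ^ (J.card + (posSupp t \ I).card)
        * br ((∑ j, (t j : ℂ) - I.card + J.card) * κ + (∑ i, (n i : ℂ) - J.card + I.card) * δ)
        * (∏ i, ∏ j, pairXX br δ κ x n J i j) * (∏ i, ∏ j, pairXY br δ κ x y n t J I i j)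
        * ∏ i, ∏ j, pairYY br δ κ y t I i j := by
  have hS : ((posSupp n).disjSum (posSupp t)) \ (J.disjSum (posSupp t \ I))
      = (posSupp n \ J).disjSum I := by
    ext a
    rcases a with a | a
    · simp
    · have := @hI a
      simp only [Finset.mem_sdiff, Finset.inr_mem_disjSum]
      tauto
  have hmap : ∀ f : ℂ → ℂ,
      ((((posSupp n).disjSum (posSupp t)).val.map (nodeW κ x y t)).map f).prod
        = ∏ a ∈ (posSupp n).disjSum (posSupp t), f (nodeW κ x y t a) := fun f => by
    rw [Multiset.map_map]; rfl
  unfold IsBracket.subsetTerm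
  rw [sum_nodeZ_sub_nodeW hI, hS, Finset.card_disjSum]
  simp only [hmap]
  simp only [Finset.prod_disjSum, nodeZ, nodeW, Sum.elim_inl, Sum.elim_inr,
    Finset.prod_mul_distrib, pairXX, pairXY, pairYY]
  simp only [← prod_mem_mem, ← prod_mem_mem_swap]
  ring

/-- The Wronski relation at a fixed total shift. -/
theorem sum_redCoef_mul_Coef_eq_zero (hb : IsBracket br) (had : Admissible br δ κ x y l)
    (hnt : (∑ i, n i) + (∑ j, t j) ≤ l) :
    ∑ J ∈ (posSupp n).powerset, ∑ I ∈ (posSupp t).powerset,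
      br ((∑ j, (t j : ℂ) - I.card + J.card) * κ + (∑ i, (n i : ℂ) - J.card + I.card) * δ)
        * (redCoef br δ κ (subInd n J) I x y
          * Coef br (-κ) (-δ) (subInd t I) J (yshift κ I y) (xshift δ (subInd n J) x)) = 0 := by
  have hni : ∀ i, n i ≤ ∑ i, n i := fun i =>
    Finset.single_le_sum (fun _ _ => Nat.zero_le _) (Finset.mem_univ i)
  have htj : ∀ j, t j ≤ ∑ j, t j := fun j =>
    Finset.single_le_sum (fun _ _ => Nat.zero_le _) (Finset.mem_univ j)
  have hnn : ∀ i j, i ≠ j → n i + n j ≤ l := fun i j hij => by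
    have : ∑ k ∈ {i, j}, n k ≤ ∑ i, n i :=
      Finset.sum_le_sum_of_subset (Finset.subset_univ _)
    rw [Finset.sum_pair hij] at this
    omega
  have hxy : ∀ i j, n i + t j ≤ l := fun i j => by have := hni i; have := htj j; omega
  have hsum := hb.subsetSum_eq_zero (X := nodeZ δ x y n) _ ((posSupp n).disjSum (posSupp t))
    (((posSupp n).disjSum (posSupp t)).val.map (nodeW κ x y t)) (κ - δ) rfl
    (by rw [Multiset.card_map]; rfl) (by
      have hcross : ∀ i ∈ posSupp n, ∀ j, br (x i + δ * n i - (y j + δ)) ≠ 0 := by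
        intro i hi j
        have hi' : 1 ≤ n i := mem_posSupp.1 hi
        convert had.xy i j (n i - 1) 0 (by have := hni i; omega) using 2
        rw [Nat.cast_sub hi']
        push_cast; ring
      rintro (i | i) hi (j | j) hj hij <;> simp only [nodeZ, Sum.elim_inl, Sum.elim_inr]
      · have hij' : i ≠ j := fun h => hij (h ▸ rfl)
        convert had.xx i j hij' (n i) (n j) (hnn i j hij') using 2
        ring
      · exact hcross i (by simpa using hi) j
      · rw [hb.sub_comm]
        exact neg_ne_zero.2 (hcross j (by simpa using hj) i)
      · have hij' : i ≠ j := fun h => hij (h ▸ rfl)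
        convert had.yy i j hij' 0 0 (by omega) using 2
        push_cast; ring)
  have hre : ∑ K ∈ ((posSupp n).disjSum (posSupp t)).powerset,
      IsBracket.subsetTerm br (κ - δ) (nodeZ δ x y n) ((posSupp n).disjSum (posSupp t))
        (((posSupp n).disjSum (posSupp t)).val.map (nodeW κ x y t)) K
      = ∑ p ∈ (posSupp n).powerset ×ˢ (posSupp t).powerset,
        IsBracket.subsetTerm br (κ - δ) (nodeZ δ x y n) ((posSupp n).disjSum (posSupp t))
        (((posSupp n).disjSum (posSupp t)).val.map (nodeW κ x y t))
          (p.1.disjSum (posSupp t \ p.2)) := by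
    symm
    refine Finset.sum_nbij' (fun p => p.1.disjSum (posSupp t \ p.2))
      (fun K => (K.toLeft, posSupp t \ K.toRight)) ?_ ?_ ?_ ?_ fun _ _ => rfl
    · rintro ⟨J, I⟩ h
      simp only [Finset.mem_product, Finset.mem_powerset] at h ⊢
      exact Finset.disjSum_mono h.1 Finset.sdiff_subset
    · intro K h
      simp only [Finset.mem_product, Finset.mem_powerset, Finset.subset_disjSum] at h ⊢
      exact ⟨h.1, Finset.sdiff_subset⟩
    · rintro ⟨J, I⟩ h
      simp only [Finset.mem_product, Finset.mem_powerset] at h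
      simp [Finset.sdiff_sdiff_eq_self h.2]
    · intro K h
      simp only [Finset.mem_powerset, Finset.subset_disjSum] at h
      simp [Finset.sdiff_sdiff_eq_self h.2, Finset.toLeft_disjSum_toRight]
  rw [hre, Finset.sum_product] at hsum
  rw [← mul_zero ((-1) ^ (posSupp t).card * (∏ i, ∏ j, constXX br δ κ x n i j)
    * (∏ i, ∏ j, constXY br δ κ x y n t i j) * ∏ i, ∏ j, constYY br δ κ y t i j), ← hsum,
    Finset.mul_sum]
  refine Finset.sum_congr rfl fun J hJ => ?_
  rw [Finset.mul_sum]
  refine Finset.sum_congr rfl fun I hI => ?_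
  rw [Finset.mem_powerset] at hJ hI
  have hsign : ((-1 : ℂ)) ^ I.card
      = (-1) ^ (posSupp t).card * (-1) ^ (posSupp t \ I).card := by
    rw [← Finset.card_sdiff_add_card_eq_card hI, pow_add, mul_right_comm, ← pow_add,
      Even.neg_one_pow ⟨_, rfl⟩, one_mul]
  rw [subsetTerm_disjSum hI, redCoef_mul_Coef hb had hJ hI hnn fun j => by
    have := htj j; omega]
  simp only [coefXX_eq had hJ fun i => by have := hni i; omega,
    coefYY_eq hb had hI fun j => by have := htj j; omega, coefXY_eq hb had hJ hI hxy,
    Finset.prod_mul_distrib]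
  rw [hsign, pow_add]
  ring

end subsetIdentity

section wronski

variable {br : ℂ → ℂ} {δ κ : ℂ} {m r : ℕ} {x : Fin m → ℂ} {y : Fin r → ℂ} {l : ℕ}

theorem mem_idxSet {m r k : ℕ} {p : (Fin m → ℕ) × Finset (Fin r)} :
    p ∈ idxSet m r k ↔ (∑ i, p.1 i) + p.2.card = k := by
  simp only [idxSet, Finset.mem_filter, Finset.mem_product, Fintype.mem_piFinset,
    Finset.mem_range, Finset.mem_univ, and_true, and_iff_right_iff_imp]
  intro h i
  have := Finset.single_le_sum (f := p.1) (fun _ _ => Nat.zero_le _) (Finset.mem_univ i)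
  omega

/-- The exponent vector `n + 1_J`. -/
def addInd {m : ℕ} (n : Fin m → ℕ) (J : Finset (Fin m)) : Fin m → ℕ :=
  fun i => n i + if i ∈ J then 1 else 0

theorem subset_posSupp_addInd {m : ℕ} (n : Fin m → ℕ) (J : Finset (Fin m)) :
    J ⊆ posSupp (addInd n J) := fun i hi => by simp [mem_posSupp, addInd, hi]

theorem subInd_addInd {m : ℕ} (n : Fin m → ℕ) (J : Finset (Fin m)) :
    subInd (addInd n J) J = n := by
  funext i
  simp [subInd, addInd]

theorem addInd_subInd {m : ℕ} {n : Fin m → ℕ} {J : Finset (Fin m)} (hJ : J ⊆ posSupp n) :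
    addInd (subInd n J) J = n := by
  funext i
  by_cases hi : i ∈ J
  · have : 0 < n i := mem_posSupp.1 (hJ hi)
    simp only [subInd, addInd, hi, if_true]
    omega
  · simp [subInd, addInd, hi]

theorem sum_addInd {m : ℕ} (n : Fin m → ℕ) (J : Finset (Fin m)) :
    ∑ i, addInd n J i = (∑ i, n i) + J.card := by
  simp [addInd, Finset.sum_add_distrib]

theorem sum_subInd {m : ℕ} {n : Fin m → ℕ} {J : Finset (Fin m)} (hJ : J ⊆ posSupp n) :
    (∑ i, subInd n J i) + J.card = ∑ i, n i := by
  rw [← sum_addInd, addInd_subInd hJ]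

theorem xshiftI_xshift (c : ℂ) {m : ℕ} (n : Fin m → ℕ) (J : Finset (Fin m)) (x : Fin m → ℂ) :
    xshiftI c J (xshift c n x) = xshift c (addInd n J) x := by
  funext i
  simp only [xshiftI, xshift, addInd]
  push_cast
  ring

theorem yshiftMu_yshift (c : ℂ) {r : ℕ} (t : Fin r → ℕ) (I : Finset (Fin r)) (y : Fin r → ℂ) :
    yshiftMu c t (yshift c I y) = yshiftMu c (addInd t I) y := by
  funext i
  simp only [yshiftMu, yshift, addInd]
  push_cast
  ring

/-- `Hop` with `Coef` replaced by `redCoef`. -/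
noncomputable def redHop (br : ℂ → ℂ) (δ κ : ℂ) {m r : ℕ} (x : Fin m → ℂ) (y : Fin r → ℂ) (k : ℕ)
    (F : (Fin m → ℂ) → (Fin r → ℂ) → ℂ) : ℂ :=
  ∑ p ∈ idxSet m r k, redCoef br δ κ p.1 p.2 x y * F (xshift δ p.1 x) (yshift κ p.2 y)

/-- Total shifts `(n, t)` with `|n| + |t| = k`. -/
def shiftSet (m r k : ℕ) : Finset ((Fin m → ℕ) × (Fin r → ℕ)) :=
  ((Fintype.piFinset fun _ : Fin m => Finset.range (k + 1)) ×ˢ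
      (Fintype.piFinset fun _ : Fin r => Finset.range (k + 1))).filter
    fun p => (∑ i, p.1 i) + (∑ j, p.2 j) = k

theorem mem_shiftSet {m r k : ℕ} {p : (Fin m → ℕ) × (Fin r → ℕ)} :
    p ∈ shiftSet m r k ↔ (∑ i, p.1 i) + (∑ j, p.2 j) = k := by
  simp only [shiftSet, Finset.mem_filter, Finset.mem_product, Fintype.mem_piFinset,
    Finset.mem_range, and_iff_right_iff_imp]
  intro h
  constructor
  · intro i
    have := Finset.single_le_sum (f := p.1) (fun _ _ => Nat.zero_le _) (Finset.mem_univ i)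
    omega
  · intro i
    have := Finset.single_le_sum (f := p.2) (fun _ _ => Nat.zero_le _) (Finset.mem_univ i)
    omega

/-- The Wronski relation between the operators `H` and `D`. -/
theorem sum_redHop_Dop (hb : IsBracket br) (had : Admissible br δ κ x y l) {k : ℕ} (hk : k ≤ l)
    (F : (Fin m → ℂ) → (Fin r → ℂ) → ℂ) :
    ∑ a ∈ Finset.range (k + 1), br (((k - a : ℕ) : ℂ) * κ + (a : ℂ) * δ)
      * redHop br δ κ x y a (Dop br δ κ m r (k - a) F) = 0 := by
  have hright : ∑ p ∈ shiftSet m r k, (∑ J ∈ (posSupp p.1).powerset, ∑ I ∈ (posSupp p.2).powerset,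
      br ((∑ j, (p.2 j : ℂ) - I.card + J.card) * κ + (∑ i, (p.1 i : ℂ) - J.card + I.card) * δ)
        * (redCoef br δ κ (subInd p.1 J) I x y
          * Coef br (-κ) (-δ) (subInd p.2 I) J (yshift κ I y) (xshift δ (subInd p.1 J) x)))
        * F (xshift δ p.1 x) (yshiftMu κ p.2 y) = 0 :=
    Finset.sum_eq_zero fun p hp => by
      rw [sum_redCoef_mul_Coef_eq_zero hb had ((mem_shiftSet.1 hp).trans_le hk), zero_mul]
  rw [← hright]
  simp only [← Finset.sum_product', Finset.sum_mul]
  simp only [redHop, Dop, Finset.mul_sum]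
  simp only [← Finset.sum_product']
  rw [Finset.sum_sigma', Finset.sum_sigma']
  refine Finset.sum_nbij'
    (fun s => ⟨(addInd s.2.1.1 s.2.2.2, addInd s.2.2.1 s.2.1.2), (s.2.2.2, s.2.1.2)⟩)
    (fun s => ⟨(∑ i, subInd s.1.1 s.2.1 i) + s.2.2.card,
      ((subInd s.1.1 s.2.1, s.2.2), (subInd s.1.2 s.2.2, s.2.1))⟩) ?_ ?_ ?_ ?_ ?_
  · rintro ⟨a, ⟨μ, I⟩, ⟨ν, J⟩⟩ h
    simp only [Finset.mem_sigma, Finset.mem_product, mem_idxSet, Finset.mem_range,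
      mem_shiftSet, Finset.mem_powerset, sum_addInd] at h ⊢
    exact ⟨by omega, subset_posSupp_addInd _ _, subset_posSupp_addInd _ _⟩
  · rintro ⟨⟨n, t⟩, ⟨J, I⟩⟩ h
    simp only [Finset.mem_sigma, Finset.mem_product, mem_idxSet, Finset.mem_range,
      mem_shiftSet, Finset.mem_powerset] at h ⊢
    obtain ⟨h1, h2, h3⟩ := h
    have := sum_subInd h2
    have := sum_subInd h3
    exact ⟨by omega, trivial, by omega⟩
  · rintro ⟨a, ⟨μ, I⟩, ⟨ν, J⟩⟩ h
    simp only [Finset.mem_sigma, Finset.mem_product, mem_idxSet, Finset.mem_range] at h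
    simp only [subInd_addInd]
    obtain ⟨-, rfl, -⟩ := h
    rfl
  · rintro ⟨⟨n, t⟩, ⟨J, I⟩⟩ h
    simp only [Finset.mem_sigma, Finset.mem_product, Finset.mem_powerset] at h
    obtain ⟨-, h2, h3⟩ := h
    simp only [addInd_subInd h2, addInd_subInd h3]
  · rintro ⟨a, ⟨μ, I⟩, ⟨ν, J⟩⟩ h
    simp only [Finset.mem_sigma, Finset.mem_product, mem_idxSet, Finset.mem_range] at h
    obtain ⟨ha, h1, h2⟩ := h
    simp only [subInd_addInd, xshiftI_xshift, yshiftMu_yshift]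
    have e1 : ∑ j, (addInd ν I j : ℂ) - I.card + J.card = ((k - a : ℕ) : ℂ) := by
      rw [← h2, ← Nat.cast_sum, sum_addInd]
      push_cast; ring
    have e2 : ∑ i, (addInd μ J i : ℂ) - J.card + I.card = (a : ℂ) := by
      rw [← h1, ← Nat.cast_sum, sum_addInd]
      push_cast; ring
    rw [e1, e2]
    ring

theorem redHop_zero (had : Admissible br δ κ x y l) (F : (Fin m → ℂ) → (Fin r → ℂ) → ℂ) :
    redHop br δ κ x y 0 F = F x y := by
  have h : idxSet m r 0 = {(fun _ => 0, ∅)} := by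
    ext ⟨μ, I⟩
    simp [mem_idxSet, funext_iff]
  have hx : ∀ i j : Fin m, i < j → br (x i - x j) ≠ 0 := fun i j hij => by
    simpa using had.xx i j hij.ne 0 0 (by omega)
  have hV : (∏ i : Fin m, ∏ j : Fin m, if i < j then br (x i - x j) / br (x i - x j) else 1)
      = 1 := Finset.prod_eq_one fun i _ => Finset.prod_eq_one fun j _ => by
    split_ifs with hij
    · exact div_self (hx i j hij)
    · rfl
  rw [redHop, h, Finset.sum_singleton]
  have e1 : xshift δ (fun _ => 0) x = x := by funext i; simp [xshift]
  have e2 : yshift κ ∅ y = y := by funext i; simp [yshift]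
  simp [e1, e2, redCoef, sfac, hV]

theorem redHop_Dop_zero (hb : IsBracket br) (had : Admissible br δ κ x y l) {k : ℕ} (hk : k ≤ l)
    (F : (Fin m → ℂ) → (Fin r → ℂ) → ℂ) :
    redHop br δ κ x y k (Dop br δ κ m r 0 F) = redHop br δ κ x y k F := by
  have h : idxSet r m 0 = {(fun _ => 0, ∅)} := by
    ext ⟨μ, I⟩
    simp [mem_idxSet, funext_iff]
  refine Finset.sum_congr rfl fun p hp => ?_
  obtain ⟨μ, I⟩ := p
  rw [mem_idxSet] at hp
  simp only at hp
  have hl : ∀ i ∈ I, 1 ≤ l := fun i hi => by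
    have : 0 < I.card := Finset.card_pos.2 ⟨i, hi⟩
    omega
  have hV : (∏ i : Fin r, ∏ j : Fin r, if i < j then br (yshift κ I y i - yshift κ I y j)
      / br (yshift κ I y i - yshift κ I y j) else 1) = 1 :=
    Finset.prod_eq_one fun i _ => Finset.prod_eq_one fun j _ => by
      split_ifs with hij
      · exact div_self (had.yshift_sub_ne_zero hl hij.ne)
      · rfl
  have hT : (∏ j : Fin r, ∏ i : Fin m, br (yshift κ I y j - xshift δ μ x i + κ)
      / br (yshift κ I y j - xshift δ μ x i + κ)) = 1 :=
    Finset.prod_eq_one fun j _ => Finset.prod_eq_one fun i _ => by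
      refine div_self ?_
      have hμ : μ i ≤ l := by
        have := Finset.single_le_sum (f := μ) (fun _ _ => Nat.zero_le _) (Finset.mem_univ i)
        omega
      rw [show yshift κ I y j - xshift δ μ x i + κ = -(xshift δ μ x i - yshift κ I y j - κ) by
        ring, hb.odd]
      refine neg_ne_zero.2 ?_
      by_cases hj : j ∈ I
      · convert had.xy i j (μ i) 0 hμ using 2
        simp only [xshift, yshift, hj, if_true]
        push_cast; ring
      · convert had.xy' i j (μ i) hμ using 2
        simp only [xshift, yshift, hj, if_false]
        ring
  congr 1
  rw [Dop, h, Finset.sum_singleton]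
  generalize xshift δ μ x = x' at *
  generalize yshift κ I y = y' at *
  have e1 : xshiftI δ ∅ x' = x' := by funext i; simp [xshiftI]
  have e2 : yshiftMu κ (fun _ => 0) y' = y' := by funext i; simp [yshiftMu]
  simp only [Finset.prod_div_distrib] at hT
  simp [e1, e2, Coef, sfac, hV, hT]

end wronski

section hessenberg

/-- The row-ordered determinant of the rows `i, …, i + n - 1` and the columns
`c, i + 1, …, i + n - 1` of `A`. -/
def orderedDet {E : Type*} [Ring E] (A : ℕ → ℕ → E) (n i c : ℕ) : E :=
  ∑ σ : Equiv.Perm (Fin n), (Equiv.Perm.sign σ : ℤ)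
    • (List.ofFn fun k : Fin n => A (i + k) (if (σ k : ℕ) = 0 then c else i + σ k)).prod

variable {E : Type*} [Ring E] {A : ℕ → ℕ → E}

theorem orderedDet_one (i c : ℕ) : orderedDet A 1 i c = A i c := by
  simp [orderedDet]

theorem orderedDet_succ (hone : ∀ i, 1 ≤ i → A i (i + 1) = 1)
    (hzero : ∀ i j, i + 1 < j → A i j = 0) {n i : ℕ} (hi : 1 ≤ i) (c : ℕ) :
    orderedDet A (n + 2) i c
      = A i c * orderedDet A (n + 1) (i + 1) (i + 1) - orderedDet A (n + 1) (i + 1) c := by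
  rw [orderedDet, ← Equiv.sum_comp Equiv.Perm.decomposeFin.symm, Fintype.sum_prod_type,
    Fin.sum_univ_succ, Fin.sum_univ_succ, sub_eq_add_neg]
  rw [Finset.sum_eq_zero (s := Finset.univ (α := Fin n)), add_zero]
  · congr 1
    · rw [orderedDet, Finset.mul_sum]
      refine Finset.sum_congr rfl fun e _ => ?_
      rw [Equiv.Perm.decomposeFin.symm_sign, List.ofFn_succ, List.prod_cons,
        mul_smul_comm]
      simp only [Equiv.Perm.decomposeFin_symm_apply_zero,
        Equiv.Perm.decomposeFin_symm_apply_succ, Equiv.swap_self, Equiv.refl_apply]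
      congr 1
      · simp
      · congr 1
        congr 2
        funext k
        rw [if_neg (by simp)]
        congr 1
        · simp; omega
        · split_ifs <;> simp [*]; omega
    · rw [orderedDet, ← Finset.sum_neg_distrib]
      refine Finset.sum_congr rfl fun e _ => ?_
      rw [Equiv.Perm.decomposeFin.symm_sign, List.ofFn_succ, List.prod_cons]
      simp only [Equiv.Perm.decomposeFin_symm_apply_zero,
        Equiv.Perm.decomposeFin_symm_apply_succ]
      rw [← neg_smul]
      congr 1
      · simp
      · rw [if_neg (by simp)]
        have h0 : A (i + (0 : Fin (n + 2))) (i + (Fin.succ (0 : Fin (n + 1)) : Fin (n + 2))) = 1 := by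
          simpa using hone i hi
        rw [h0, one_mul]
        congr 2
        funext k
        congr 1
        · simp; omega
        · by_cases hk : e k = 0
          · simp [hk]
          · have h1 : Equiv.swap (0 : Fin (n + 2)) (Fin.succ 0) (e k).succ = (e k).succ :=
              Equiv.swap_apply_of_ne_of_ne (Fin.succ_ne_zero _)
                fun h => hk (Fin.succ_injective _ h)
            have h2 : ((e k : Fin (n + 1)) : ℕ) ≠ 0 := fun h => hk (Fin.ext h)
            rw [h1, if_neg (by simp), if_neg h2, Fin.val_succ]
            omega
  · intro p _
    refine Finset.sum_eq_zero fun e _ => ?_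
    rw [List.ofFn_succ, List.prod_cons, Equiv.Perm.decomposeFin_symm_apply_zero]
    rw [if_neg (by simp), hzero, zero_mul, smul_zero]
    simp

theorem sum_orderedDet {V B : Type*} [AddCommGroup V] [AddCommGroup B]
    (A : ℕ → ℕ → AddMonoid.End V) (φ : ℕ → V →+ B) (l : ℕ)
    (hone : ∀ i, 1 ≤ i → A i (i + 1) = 1) (hzero : ∀ i j, i + 1 < j → A i j = 0)
    (hφ : ∀ i, 1 ≤ i → i ≤ l → ∀ G, ∑ c ∈ Finset.range i, φ c (A i (c + 1) G) = -φ i G)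
    (n : ℕ) : ∀ i, 1 ≤ i → i + n ≤ l → ∀ F : V,
      ∑ c ∈ Finset.range i, φ c (orderedDet A (n + 1) i (c + 1) F)
        = (-1 : ℤ) ^ (n + 1) • φ (i + n) F := by
  induction n with
  | zero =>
    intro i hi hl F
    simp [orderedDet_one, hφ i hi hl]
  | succ n ih =>
    intro i hi hl F
    have h := ih (i + 1) (by omega) (by omega) F
    rw [Finset.sum_range_succ] at h
    have happ : ∀ (f g h : AddMonoid.End V) (v : V), (f * g - h) v = f (g v) - h v :=
      fun _ _ _ _ => rfl
    simp only [orderedDet_succ hone hzero hi, happ, map_sub, Finset.sum_sub_distrib, hφ i hi (by omega)]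
    rw [show i + (n + 1) = i + 1 + n by ring, pow_succ (-1 : ℤ) (n + 1), mul_neg_one, neg_smul, ← h]
    abel

end hessenberg

section assembly

variable {br : ℂ → ℂ} {δ κ : ℂ} {m r : ℕ} {x : Fin m → ℂ} {y : Fin r → ℂ} {l : ℕ}

theorem sum_single_add_single {α : Type*} [Fintype α] [DecidableEq α] (i j : α) (a b : ℕ) :
    ∑ k, ((Pi.single i a : α → ℕ) + (Pi.single j b : α → ℕ)) k = a + b := by
  simp [Finset.sum_add_distrib]

theorem admissible_of_CDenomNZ (hb : IsBracket br)
    (hδ : ∀ n : ℕ, 1 ≤ n → br ((n : ℂ) * δ) ≠ 0) (hκ : ∀ n : ℕ, 1 ≤ n → br ((n : ℂ) * κ) ≠ 0)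
    (hl : 1 ≤ l)
    (hD : ∀ (s : Fin m → ℕ) (t : Fin r → ℕ),
      (∑ i, s i) + (∑ j, t j) ≤ l → ∀ k ≤ l, ∀ p ∈ idxSet r m k,
        CDenomNZ br (-κ) p.1 p.2
          (fun j => y j - κ * (t j : ℂ)) (fun i => x i + δ * (s i : ℂ))) :
    Admissible br δ κ x y l where
  delta := hδ
  kappa := hκ
  xx i j hij a b hab := by
    have h := (hD (Pi.single i a + Pi.single j b) 0
      (by rw [sum_single_add_single]; simpa using hab) 1 hl (0, {i}) (by simp [mem_idxSet])).2.1
      i (by simp) j (by simpa using hij.symm)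
    convert h using 2
    simp [hij, hij.symm]
    ring
  yy i j hij a b hab := by
    have h := (hD 0 (Pi.single i a + Pi.single j b)
      (by rw [sum_single_add_single]; simpa using hab) 0 (by omega) (0, ∅)
      (by simp [mem_idxSet])).1
    rcases lt_or_gt_of_ne hij with h' | h'
    · convert h i j h' using 2
      simp [hij, hij.symm]
      ring
    · rw [← neg_ne_zero, ← hb.odd]
      convert h j i h' using 2
      simp [hij, hij.symm]
      ring
  xy i j a b hab := by
    have h := (hD (Pi.single i a) (Pi.single j b) (by simpa using hab) 1 hl (0, {i})
      (by simp [mem_idxSet])).2.2.2.1 j i (by simp)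
    rw [← neg_ne_zero, ← hb.odd]
    convert h using 2
    simp
    ring
  xy' i j a ha := by
    have h := (hD (Pi.single i a) 0 (by simpa using ha) 0 (by omega) (0, ∅)
      (by simp [mem_idxSet])).2.2.2.2 j i (by simp)
    rw [← neg_ne_zero, ← hb.odd]
    convert h using 2
    simp
    ring

theorem redHop_eq_Hop {k : ℕ} (hH : ∀ p ∈ idxSet m r k, CDenomNZ br δ p.1 p.2 x y)
    (F : (Fin m → ℂ) → (Fin r → ℂ) → ℂ) :
    redHop br δ κ x y k F = Hop br δ κ m r k F x y := by
  refine Finset.sum_congr rfl fun p hp => ?_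
  have h := (hH p hp).2.2.2.2
  unfold redCoef Coef
  congr 2
  refine Finset.prod_congr rfl fun i _ => ?_
  congr 1
  refine Finset.prod_congr rfl fun j hj => ?_
  split_ifs with hμ
  · have hne := h i j hj
    have e : x i - y j + ((p.1 i : ℂ) - 1) * δ = x i - y j - δ := by rw [hμ]; push_cast; ring
    rw [e] at hne ⊢
    exact (div_self hne).symm
  · rfl

/-- `redHop` as an additive map. -/
noncomputable def redHopHom (br : ℂ → ℂ) (δ κ : ℂ) {m r : ℕ} (x : Fin m → ℂ) (y : Fin r → ℂ)
    (k : ℕ) : ((Fin m → ℂ) → (Fin r → ℂ) → ℂ) →+ ℂ where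
  toFun := redHop br δ κ x y k
  map_zero' := by simp [redHop]
  map_add' F G := by simp [redHop, mul_add, Finset.sum_add_distrib]

/-- `Aop` as an additive endomorphism. -/
noncomputable def AopHom (br : ℂ → ℂ) (δ κ : ℂ) (m r i j : ℕ) :
    AddMonoid.End ((Fin m → ℂ) → (Fin r → ℂ) → ℂ) where
  toFun := Aop br δ κ m r i j
  map_zero' := by
    funext x y
    simp [Aop, Dop]
  map_add' F G := by
    funext x y
    simp only [Aop, Dop, Pi.add_apply]
    split_ifs <;> simp [mul_add, Finset.sum_add_distrib]

theorem redHop_const_mul (k : ℕ) (c : ℂ) (F : (Fin m → ℂ) → (Fin r → ℂ) → ℂ) :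
    redHop br δ κ x y k (fun x y => c * F x y) = c * redHop br δ κ x y k F := by
  simp only [redHop, Finset.mul_sum]
  exact Finset.sum_congr rfl fun p _ => by ring

theorem sum_redHop_Aop (hb : IsBracket br) (had : Admissible br δ κ x y l) {i : ℕ} (hi : 1 ≤ i)
    (hil : i ≤ l) (G : (Fin m → ℂ) → (Fin r → ℂ) → ℂ) :
    ∑ c ∈ Finset.range i, redHop br δ κ x y c (Aop br δ κ m r i (c + 1) G)
      = -redHop br δ κ x y i G := by
  have hne := had.delta i hi
  have h := sum_redHop_Dop hb had hil G
  rw [Finset.sum_range_succ, Nat.sub_self, redHop_Dop_zero hb had hil, Nat.cast_zero, zero_mul,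
    zero_add] at h
  have hA : ∀ c ∈ Finset.range i, redHop br δ κ x y c (Aop br δ κ m r i (c + 1) G)
      = (br (i * δ))⁻¹ * (br (((i - c : ℕ) : ℂ) * κ + (c : ℂ) * δ)
        * redHop br δ κ x y c (Dop br δ κ m r (i - c) G)) := by
    intro c hc
    rw [Finset.mem_range] at hc
    have e : Aop br δ κ m r i (c + 1) G = fun x y =>
        (br (((i - c : ℕ) : ℂ) * κ + (c : ℂ) * δ) / br (i * δ)) * Dop br δ κ m r (i - c) G x y := by
      funext x y
      have h1 : ¬ i - c = 0 := by omega
      rw [Aop, if_pos (by omega), Nat.add_sub_add_right, if_neg h1]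
      simp
    rw [e, redHop_const_mul]
    ring
  rw [Finset.sum_congr rfl hA, ← Finset.mul_sum, eq_neg_of_add_eq_zero_left h]
  field_simp

theorem detComp_eq (σ : Equiv.Perm (Fin l)) (F : (Fin m → ℂ) → (Fin r → ℂ) → ℂ) :
    detComp br δ κ m r l σ F
      = (List.ofFn fun i : Fin l => AopHom br δ κ m r (i.1 + 1) ((σ i).1 + 1)).prod F := by
  have h : ∀ L : List (AddMonoid.End ((Fin m → ℂ) → (Fin r → ℂ) → ℂ)),
      (L.map fun A F => A F).foldr (fun A G => A G) F
        = L.prod F := by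
    intro L
    induction L with
    | nil => rfl
    | cons A L ih =>
      rw [List.map_cons, List.foldr_cons, ih, List.prod_cons]
      rfl
  rw [← h, List.map_ofFn]
  rfl

theorem sum_detComp (F : (Fin m → ℂ) → (Fin r → ℂ) → ℂ) :
    ∑ σ : Equiv.Perm (Fin l), ((Equiv.Perm.sign σ : ℤ) : ℂ) * detComp br δ κ m r l σ F x y
      = orderedDet (AopHom br δ κ m r) l 1 1 F x y := by
  have happ : ∀ f : Equiv.Perm (Fin l) → AddMonoid.End ((Fin m → ℂ) → (Fin r → ℂ) → ℂ),
      (∑ σ, f σ) F x y = ∑ σ, f σ F x y := fun f => by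
    have : (∑ σ, f σ) F = ∑ σ, f σ F := map_sum (AddMonoidHom.eval F) f Finset.univ
    rw [this, Finset.sum_apply, Finset.sum_apply]
  rw [orderedDet, happ]
  refine Finset.sum_congr rfl fun σ _ => ?_
  have hs : ∀ (z : ℤ) (f : AddMonoid.End ((Fin m → ℂ) → (Fin r → ℂ) → ℂ)),
      (z • f) F x y = (z : ℂ) * f F x y := fun z f => by
    rw [← zsmul_eq_mul]; rfl
  rw [hs, detComp_eq]
  have hk : (fun i : Fin l => AopHom br δ κ m r (i.1 + 1) ((σ i).1 + 1))
      = fun k : Fin l => AopHom br δ κ m r (1 + k) (if (σ k : ℕ) = 0 then 1 else 1 + σ k) := by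
    funext k
    congr 1
    · ring
    · split_ifs with h
      · rw [h]
      · ring
  rw [hk]

end assembly
/-- Determinant formula:
`H_{m,r}^{(l)} = (-1)^l Σ_{σ ∈ S_l} sgn(σ) A_{1,σ(1)} ∘ ⋯ ∘ A_{l,σ(l)}`
at every admissible point. -/
theorem Hop_det_formula
    (br : ℂ → ℂ) (hodd : ∀ z : ℂ, br (-z) = -br z)
    (hent : Differentiable ℂ br) (hnz : br ≠ 0)
    (hW : ∀ a b c d : ℂ,
      br (a + b) * br (a - b) * br (c + d) * br (c - d)
        + br (a + d) * br (a - d) * br (b + c) * br (b - c)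
        = br (a + c) * br (a - c) * br (b + d) * br (b - d))
    (δ κ : ℂ)
    (hδ : ∀ n : ℕ, 1 ≤ n → br ((n : ℂ) * δ) ≠ 0)
    (hκ : ∀ n : ℕ, 1 ≤ n → br ((n : ℂ) * κ) ≠ 0)
    (m r l : ℕ) (hl : 1 ≤ l) (F : (Fin m → ℂ) → (Fin r → ℂ) → ℂ)
    (x : Fin m → ℂ) (y : Fin r → ℂ)
    (hH : ∀ p ∈ idxSet m r l, CDenomNZ br δ p.1 p.2 x y)
    (hD : ∀ (s : Fin m → ℕ) (t : Fin r → ℕ),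
      (∑ i, s i) + (∑ j, t j) ≤ l → ∀ k ≤ l, ∀ p ∈ idxSet r m k,
        CDenomNZ br (-κ) p.1 p.2
          (fun j => y j - κ * (t j : ℂ)) (fun i => x i + δ * (s i : ℂ))) :
    Hop br δ κ m r l F x y
      = (-1 : ℂ) ^ l * ∑ σ : Equiv.Perm (Fin l),
          ((Equiv.Perm.sign σ : ℤ) : ℂ) * detComp br δ κ m r l σ F x y := by
  have hb : IsBracket br := ⟨hodd, hent, hnz, hW⟩
  have had := admissible_of_CDenomNZ hb hδ hκ hl hD
  obtain ⟨n, rfl⟩ : ∃ n, l = n + 1 := ⟨l - 1, by omega⟩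
  have h := sum_orderedDet (AopHom br δ κ m r) (redHopHom br δ κ x y) (n + 1)
    (fun i hi => by
      ext F : 1
      funext x y
      change Aop br δ κ m r i (i + 1) F x y = F x y
      simp [Aop, hδ i hi])
    (fun i j hij => by
      ext F : 1
      change Aop br δ κ m r i j F = 0
      rw [Aop, if_neg (by omega)]
      rfl)
    (fun i hi hil G => sum_redHop_Aop hb had hi hil G) n 1 le_rfl (by omega) F
  rw [Finset.sum_range_one] at h
  change redHop br δ κ x y 0 _ = _ • redHop br δ κ x y (1 + n) F at h
  rw [redHop_zero had, add_comm 1 n, redHop_eq_Hop hH, zero_add] at h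
  rw [sum_detComp, h, zsmul_eq_mul, ← mul_assoc]
  push_cast
  rw [← mul_pow, neg_one_mul, neg_neg, one_pow, one_mul]
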